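/- arXiv:1001.1822 — 2 statements merged into one kernel-verified Lean document; each statement's English description precedes it below -/
import Mathlib

section
/- Suppose there exist a C² function W : ℝⁿ → ℝ with W ≥ 1, a point x₀ ∈ ℝⁿ and constants b, c > 0 such that LW(x) ≤ (−c|x − x₀|² + b) W(x) for all x, and suppose there exists δ ∈ ℝ (possibly negative) such that Hess V(x) ≥ δ·Id for all x (i.e. the Hessian of V minus δ times the identity is positive semidefinite everywhere). Then μ satisfies a logarithmic Sobolev inequality: there exists C > 0 such that for every smooth compactly supported function f, Ent_μ(f²) ≤ C ∫ |∇f|² dμ, where Ent_μ(g) = ∫ g log g dμ − (∫ g dμ) log(∫ g dμ). -/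
open MeasureTheory Real Set
open scoped ENNReal RealInnerProductSpace

noncomputable section

abbrev En (n : ℕ) := EuclideanSpace ℝ (Fin n)

/-- The Laplacian on `ℝⁿ`: sum of second partial derivatives. -/
def lapl {n : ℕ} (g : En n → ℝ) (x : En n) : ℝ :=
  ∑ i : Fin n,
    fderiv ℝ (fun y => fderiv ℝ g y (EuclideanSpace.single i 1)) x (EuclideanSpace.single i 1)

/-- The diffusion operator `L g = Δ g - ∇V · ∇g`. -/
def Lop {n : ℕ} (V g : En n → ℝ) (x : En n) : ℝ :=
  lapl g x - ⟪gradient V x, gradient g x⟫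

/-- The Boltzmann measure `dμ = e^{-V}/Z dx`. -/
def boltz {n : ℕ} (V : En n → ℝ) : Measure (En n) :=
  (volume : Measure (En n)).withDensity
    (fun x => ENNReal.ofReal (Real.exp (-V x) / ∫ y, Real.exp (-V y)))

section

variable {n : ℕ}

lemma integral_mul_divergence_eq (V u X : En n → ℝ) (hV : ContDiff ℝ 1 V) (hu : ContDiff ℝ 1 u)
    (hcu : HasCompactSupport u) (hX : ContDiff ℝ 1 X) (v : En n) :
    ∫ x, u x * (fderiv ℝ X x v - X x * fderiv ℝ V x v) * exp (-V x) =
      -∫ x, fderiv ℝ u x v * X x * exp (-V x) := by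
  have hg : ContDiff ℝ 1 (fun x => X x * exp (-V x)) := by fun_prop
  have hgd : ∀ x, fderiv ℝ (fun x => X x * exp (-V x)) x v =
      (fderiv ℝ X x v - X x * fderiv ℝ V x v) * exp (-V x) := by
    intro x
    have h1 := (hX.differentiable one_ne_zero x).hasFDerivAt
    have h2 := (hV.differentiable one_ne_zero x).hasFDerivAt
    rw [(h1.fun_mul h2.fun_neg.exp).fderiv]
    simp
    ring
  have key := integral_mul_fderiv_eq_neg_fderiv_mul_of_integrable (μ := (volume : Measure (En n)))
    (f := u) (g := fun x => X x * exp (-V x)) (v := v) ?_ ?_ ?_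
    (fun x _ => hu.differentiable one_ne_zero x) (fun x _ => hg.differentiable one_ne_zero x)
  · simp only [hgd] at key
    simpa only [mul_assoc] using key
  · have hc : Continuous (fun x => fderiv ℝ u x v) :=
      (hu.continuous_fderiv one_ne_zero).clm_apply continuous_const
    refine (hc.mul hg.continuous).integrable_of_hasCompactSupport ?_
    exact ((hcu.fderiv (𝕜 := ℝ)).comp_left (g := fun L : En n →L[ℝ] ℝ => L v) (by simp)).mul_right
  · have hc : Continuous (fun x => fderiv ℝ (fun x => X x * exp (-V x)) x v) :=
      (hg.continuous_fderiv one_ne_zero).clm_apply continuous_const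
    exact (hu.continuous.mul hc).integrable_of_hasCompactSupport hcu.mul_right
  · exact (hu.continuous.mul hg.continuous).integrable_of_hasCompactSupport hcu.mul_right

lemma le_of_le_iteratedFDeriv_two {V : En n → ℝ} (hV : ContDiff ℝ 2 V) {δ : ℝ}
    (hHess : ∀ x v : En n, δ * ‖v‖ ^ 2 ≤ iteratedFDeriv ℝ 2 V x ![v, v]) (y z : En n) :
    V y + fderiv ℝ V y (z - y) + δ / 2 * ‖z - y‖ ^ 2 ≤ V z := by
  set v := z - y with hv
  have hl : ∀ t : ℝ, HasDerivAt (fun t : ℝ => y + t • v) v t := fun t => by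
    simpa using ((hasDerivAt_id t).smul_const v).const_add y
  have hV' : ContDiff ℝ 1 (fderiv ℝ V) := hV.fderiv_right (by norm_num)
  have hq : ∀ t : ℝ, HasDerivAt (fun t : ℝ => δ / 2 * ‖v‖ ^ 2 * t ^ 2) (δ * ‖v‖ ^ 2 * t) t :=
    fun t => by
      refine ((hasDerivAt_pow 2 t).const_mul (δ / 2 * ‖v‖ ^ 2)).congr_deriv ?_
      norm_num
      ring
  have h1 : ∀ t : ℝ, HasDerivAt (fun t : ℝ => V (y + t • v) - δ / 2 * ‖v‖ ^ 2 * t ^ 2)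
      (fderiv ℝ V (y + t • v) v - δ * ‖v‖ ^ 2 * t) t := fun t =>
    ((hV.differentiable two_ne_zero _).hasFDerivAt.comp_hasDerivAt t (hl t)).sub (hq t)
  have h2 : ∀ t : ℝ, HasDerivAt (fun t : ℝ => fderiv ℝ V (y + t • v) v - δ * ‖v‖ ^ 2 * t)
      (fderiv ℝ (fderiv ℝ V) (y + t • v) v v - δ * ‖v‖ ^ 2) t := fun t => by
    have h3 := (hV'.differentiable one_ne_zero _).hasFDerivAt.comp_hasDerivAt t (hl t)
    have h4 := h3.clm_apply (hasDerivAt_const t v)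
    refine (h4.sub ((hasDerivAt_id t).const_mul (δ * ‖v‖ ^ 2))).congr_deriv ?_
    simp
  have hc : ConvexOn ℝ univ (fun t : ℝ => V (y + t • v) - δ / 2 * ‖v‖ ^ 2 * t ^ 2) := by
    have e1 : deriv (fun t : ℝ => V (y + t • v) - δ / 2 * ‖v‖ ^ 2 * t ^ 2) =
      fun t : ℝ => fderiv ℝ V (y + t • v) v - δ * ‖v‖ ^ 2 * t := funext fun t => (h1 t).deriv
    refine convexOn_univ_of_deriv2_nonneg (fun t => (h1 t).differentiableAt) ?_ ?_
    · rw [e1]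
      exact fun t => (h2 t).differentiableAt
    · intro t
      rw [Function.iterate_succ, Function.iterate_one, Function.comp_apply, e1, (h2 t).deriv]
      have := hHess (y + t • v) v
      rw [iteratedFDeriv_two_apply] at this
      simpa using this
  have h := hc.le_slope_of_hasDerivAt (mem_univ 0) (mem_univ 1) one_pos (h1 0)
  rw [slope_def_field] at h
  simp at h
  have e : y + v = z := by simp [hv]
  rw [e] at h
  linarith

lemma sum_fderiv_single_mul (L : En n →L[ℝ] ℝ) (v : En n) :
    ∑ i, L (EuclideanSpace.single i 1) * v i = L v := by
  have h : v = ∑ i, v i • EuclideanSpace.single i (1 : ℝ) := by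
    have := (EuclideanSpace.basisFun (Fin n) ℝ).sum_repr v
    simpa using this.symm
  conv_rhs => rw [h]
  simp [mul_comm]

lemma gradient_apply_eq_fderiv_single (f : En n → ℝ) (x : En n) (i : Fin n) :
    gradient f x i = fderiv ℝ f x (EuclideanSpace.single i 1) := by
  have h : fderiv ℝ f x (EuclideanSpace.single i 1) =
      ⟪gradient f x, EuclideanSpace.single i 1⟫ := by
    simp [gradient]
  rw [h, EuclideanSpace.inner_single_right]
  simp

lemma norm_gradient_eq (f : En n → ℝ) (x : En n) : ‖gradient f x‖ = ‖fderiv ℝ f x‖ := by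
  simp [gradient]

lemma inner_gradient_eq_fderiv (f g : En n → ℝ) (x : En n) :
    ⟪gradient f x, gradient g x⟫ = fderiv ℝ f x (gradient g x) := by
  simp [gradient]

lemma integral_mul_sum_divergence_eq (V u : En n → ℝ) (X : Fin n → En n → ℝ)
    (hV : ContDiff ℝ 1 V) (hu : ContDiff ℝ 1 u) (hcu : HasCompactSupport u)
    (hX : ∀ i, ContDiff ℝ 1 (X i)) :
    ∫ x, u x * (∑ i, (fderiv ℝ (X i) x (EuclideanSpace.single i 1)
        - X i x * fderiv ℝ V x (EuclideanSpace.single i 1))) * exp (-V x) =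
      -∫ x, (∑ i, fderiv ℝ u x (EuclideanSpace.single i 1) * X i x) * exp (-V x) := by
  have hXc := fun i => (hX i).continuous
  have hXd := fun i => (hX i).continuous_fderiv one_ne_zero
  have hVc := hV.continuous
  have hVd := hV.continuous_fderiv one_ne_zero
  have huc := hu.continuous
  have hud := hu.continuous_fderiv one_ne_zero
  simp only [Finset.mul_sum, Finset.sum_mul]
  rw [integral_finsetSum, integral_finsetSum, ← Finset.sum_neg_distrib]
  · exact Finset.sum_congr rfl fun i _ => integral_mul_divergence_eq V u (X i) hV hu hcu (hX i) _
  · intro i _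
    refine Continuous.integrable_of_hasCompactSupport (by fun_prop) ?_
    exact ((hcu.fderiv (𝕜 := ℝ)).comp_left
      (g := fun L : En n →L[ℝ] ℝ => L (EuclideanSpace.single i 1)) (by simp)).mul_right.mul_right
  · intro i _
    exact Continuous.integrable_of_hasCompactSupport (by fun_prop) hcu.mul_right.mul_right

lemma integral_sq_mul_fderiv_radial_eq (V φ : En n → ℝ) (hV : ContDiff ℝ 1 V)
    (hφ : ContDiff ℝ 1 φ) (hcφ : HasCompactSupport φ) (x₀ : En n) :
    ∫ x, φ x ^ 2 * (n - fderiv ℝ V x (x - x₀)) * exp (-V x) =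
      -∫ x, 2 * φ x * fderiv ℝ φ x (x - x₀) * exp (-V x) := by
  have hX : ∀ i : Fin n, ContDiff ℝ 1 (fun x : En n => (x - x₀) i) := fun i => by
    simp only [PiLp.sub_apply]
    fun_prop
  have hc : HasCompactSupport (fun x => φ x ^ 2) :=
    hcφ.comp_left (g := fun t : ℝ => t ^ 2) (by simp)
  have h := integral_mul_sum_divergence_eq V (fun x => φ x ^ 2) (fun i x => (x - x₀) i) hV
    (hφ.pow 2) hc hX
  have h1 : ∀ (x : En n) (i : Fin n), fderiv ℝ (fun x : En n => (x - x₀) i) x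
      (EuclideanSpace.single i 1) = 1 := fun x i => by
    have : HasFDerivAt (fun x : En n => (x - x₀) i) (EuclideanSpace.proj i : En n →L[ℝ] ℝ) x := by
      simp only [PiLp.sub_apply]
      exact (EuclideanSpace.proj i : En n →L[ℝ] ℝ).hasFDerivAt.sub_const _
    rw [this.fderiv]
    simp
  have h2 : ∀ x, fderiv ℝ (fun x => φ x ^ 2) x = (2 * φ x) • fderiv ℝ φ x := fun x => by
    rw [((hφ.differentiable one_ne_zero x).hasFDerivAt.pow 2).fderiv]
    simp
  simp only [h1, Finset.sum_sub_distrib, sum_fderiv_single_mul, h2] at h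
  have h3 : ∀ x, ∑ i, (x - x₀) i * fderiv ℝ V x (EuclideanSpace.single i 1) =
      fderiv ℝ V x (x - x₀) := fun x => by
    rw [← sum_fderiv_single_mul]
    simp only [mul_comm]
  simp only [h3] at h
  simpa using h

lemma HasCompactSupport.norm_fderiv_sq {φ : En n → ℝ} (h : HasCompactSupport φ) :
    HasCompactSupport (fun x => ‖fderiv ℝ φ x‖ ^ 2) :=
  (h.fderiv (𝕜 := ℝ)).comp_left (g := fun L : En n →L[ℝ] ℝ => ‖L‖ ^ 2) (by simp)

lemma HasCompactSupport.sq {φ : En n → ℝ} (h : HasCompactSupport φ) :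
    HasCompactSupport (fun x => φ x ^ 2) :=
  h.comp_left (g := fun t : ℝ => t ^ 2) (by simp)

lemma inner_gradient_sq_div_le {φ W : En n → ℝ} (hφ : ContDiff ℝ 1 φ)
    (hW : ContDiff ℝ 1 W) (hW1 : ∀ x, 1 ≤ W x) (x : En n) :
    fderiv ℝ (fun x => φ x ^ 2 / W x) x (gradient W x) ≤ ‖fderiv ℝ φ x‖ ^ 2 := by
  have hW0 : W x ≠ 0 := (zero_lt_one.trans_le (hW1 x)).ne'
  have hd := ((hφ.differentiable one_ne_zero x).hasFDerivAt.pow 2).fun_mul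
    ((hasDerivAt_inv hW0).comp_hasFDerivAt x (hW.differentiable one_ne_zero x).hasFDerivAt)
  have he : (fun x => φ x ^ 2 / W x) = fun x => φ x ^ 2 * (Inv.inv ∘ W) x := by
    ext x
    simp [div_eq_mul_inv]
  rw [he, hd.fderiv]
  have h1 : fderiv ℝ W x (gradient W x) = ‖gradient W x‖ ^ 2 := by
    rw [← inner_gradient_eq_fderiv, real_inner_self_eq_norm_sq]
  have h2 : fderiv ℝ φ x (gradient W x) ≤ ‖fderiv ℝ φ x‖ * ‖gradient W x‖ :=
    (le_abs_self _).trans ((fderiv ℝ φ x).le_opNorm _)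
  have h3 : -fderiv ℝ φ x (gradient W x) ≤ ‖fderiv ℝ φ x‖ * ‖gradient W x‖ :=
    (neg_le_abs _).trans ((fderiv ℝ φ x).le_opNorm _)
  have h4 : φ x / W x * fderiv ℝ φ x (gradient W x) ≤
      |φ x / W x| * (‖fderiv ℝ φ x‖ * ‖gradient W x‖) := by
    refine (le_abs_self _).trans ?_
    rw [abs_mul]
    exact mul_le_mul_of_nonneg_left (abs_le'.2 ⟨h2, h3⟩) (abs_nonneg _)
  have h5 : (φ x / W x) ^ 2 = |φ x / W x| ^ 2 := (sq_abs _).symm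
  simp only [add_apply, smul_apply, smul_eq_mul, h1,
    Function.comp_apply]
  calc _ = 2 * (φ x / W x * fderiv ℝ φ x (gradient W x)) -
        (φ x / W x) ^ 2 * ‖gradient W x‖ ^ 2 := by
        field_simp
        simp
        ring
    _ ≤ _ := by
      rw [h5]
      nlinarith [sq_nonneg (‖fderiv ℝ φ x‖ - |φ x / W x| * ‖gradient W x‖)]

lemma integral_norm_sub_sq_mul_sq_le_of_lyapunov {V W : En n → ℝ} (hV : ContDiff ℝ 2 V)
    (hW : ContDiff ℝ 2 W) (hW1 : ∀ x, 1 ≤ W x) {x₀ : En n} {b c : ℝ}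
    (hLyap : ∀ x, Lop V W x ≤ (-c * ‖x - x₀‖ ^ 2 + b) * W x)
    {φ : En n → ℝ} (hφ : ContDiff ℝ 1 φ) (hcφ : HasCompactSupport φ) :
    c * ∫ x, φ x ^ 2 * ‖x - x₀‖ ^ 2 * exp (-V x) ≤
      (∫ x, ‖fderiv ℝ φ x‖ ^ 2 * exp (-V x)) + b * ∫ x, φ x ^ 2 * exp (-V x) := by
  have hV1 : ContDiff ℝ 1 V := hV.of_le (by norm_num)
  have hW' : ContDiff ℝ 1 W := hW.of_le (by norm_num)
  have hW0 : ∀ x, W x ≠ 0 := fun x => (zero_lt_one.trans_le (hW1 x)).ne'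
  have hVc := hV.continuous
  have hVd := hV1.continuous_fderiv one_ne_zero
  have hWd := hW'.continuous_fderiv one_ne_zero
  have hφc := hφ.continuous
  have hφd := hφ.continuous_fderiv one_ne_zero
  have hψ : ContDiff ℝ 1 (fun x => φ x ^ 2 / W x) := (hφ.pow 2).div hW' hW0
  have hψc : HasCompactSupport (fun x => φ x ^ 2 / W x) := by
    simp only [div_eq_mul_inv]
    exact hcφ.sq.mul_right
  have hX : ∀ i : Fin n, ContDiff ℝ 1 (fun x => fderiv ℝ W x (EuclideanSpace.single i 1)) :=
    fun i => (hW.fderiv_right (by norm_num)).clm_apply contDiff_const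
  have h := integral_mul_sum_divergence_eq V _ (fun i x => fderiv ℝ W x (EuclideanSpace.single i 1))
    hV1 hψ hψc hX
  have e1 : ∀ x, ∑ i, (fderiv ℝ (fun x => fderiv ℝ W x (EuclideanSpace.single i 1)) x
      (EuclideanSpace.single i 1) - fderiv ℝ W x (EuclideanSpace.single i 1) *
        fderiv ℝ V x (EuclideanSpace.single i 1)) = Lop V W x := fun x => by
    rw [Finset.sum_sub_distrib, Lop, lapl, inner_gradient_eq_fderiv, ← sum_fderiv_single_mul]
    simp only [gradient_apply_eq_fderiv_single, mul_comm]
  have hLc : Continuous (Lop V W) := by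
    rw [← funext e1]
    have hXd := fun i => (hX i).continuous_fderiv one_ne_zero
    fun_prop
  have e2 : ∀ x, ∑ i, fderiv ℝ (fun x => φ x ^ 2 / W x) x (EuclideanSpace.single i 1) *
      fderiv ℝ W x (EuclideanSpace.single i 1) =
      fderiv ℝ (fun x => φ x ^ 2 / W x) x (gradient W x) := fun x => by
    rw [← sum_fderiv_single_mul]
    simp only [gradient_apply_eq_fderiv_single]
  simp only [e1, e2] at h
  have hI1 : Integrable (fun x => φ x ^ 2 * ‖x - x₀‖ ^ 2 * exp (-V x)) :=
    Continuous.integrable_of_hasCompactSupport (by fun_prop) hcφ.sq.mul_right.mul_right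
  have hI2 : Integrable (fun x => φ x ^ 2 * exp (-V x)) :=
    Continuous.integrable_of_hasCompactSupport (by fun_prop) hcφ.sq.mul_right
  have hI3 : Integrable (fun x => ‖fderiv ℝ φ x‖ ^ 2 * exp (-V x)) :=
    Continuous.integrable_of_hasCompactSupport (by fun_prop) hcφ.norm_fderiv_sq.mul_right
  have hψcont := hψ.continuous
  have hI4 : Integrable (fun x => φ x ^ 2 / W x * Lop V W x * exp (-V x)) :=
    Continuous.integrable_of_hasCompactSupport (by fun_prop) hψc.mul_right.mul_right
  have hI5 : Integrable (fun x => fderiv ℝ (fun x => φ x ^ 2 / W x) x (gradient W x)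
      * exp (-V x)) := by
    have hd := hψ.continuous_fderiv one_ne_zero
    have hgW : Continuous (gradient W) := by
      unfold gradient
      fun_prop
    refine Continuous.integrable_of_hasCompactSupport (by fun_prop) (HasCompactSupport.mul_right ?_)
    refine (hψc.fderiv (𝕜 := ℝ)).mono' fun x hx => subset_tsupport _ ?_
    intro h0
    apply hx
    simp [h0]
  have h6 : ∫ x, fderiv ℝ (fun x => φ x ^ 2 / W x) x (gradient W x) * exp (-V x) ≤
      ∫ x, ‖fderiv ℝ φ x‖ ^ 2 * exp (-V x) :=
    integral_mono hI5 hI3 fun x =>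
      mul_le_mul_of_nonneg_right (inner_gradient_sq_div_le hφ hW' hW1 x) (exp_pos _).le
  have h7 : ∫ x, φ x ^ 2 / W x * Lop V W x * exp (-V x) ≤
      ∫ x, (-c * (φ x ^ 2 * ‖x - x₀‖ ^ 2 * exp (-V x)) + b * (φ x ^ 2 * exp (-V x))) := by
    refine integral_mono hI4 ((hI1.const_mul _).add (hI2.const_mul _)) fun x => ?_
    have hWp : 0 < W x := zero_lt_one.trans_le (hW1 x)
    have : φ x ^ 2 / W x * Lop V W x ≤ φ x ^ 2 / W x * ((-c * ‖x - x₀‖ ^ 2 + b) * W x) :=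
      mul_le_mul_of_nonneg_left (hLyap x) (by positivity)
    calc _ ≤ φ x ^ 2 / W x * ((-c * ‖x - x₀‖ ^ 2 + b) * W x) * exp (-V x) :=
          mul_le_mul_of_nonneg_right this (exp_pos _).le
      _ = _ := by
          field_simp
  rw [integral_add (hI1.const_mul _) (hI2.const_mul _), integral_const_mul, integral_const_mul]
    at h7
  linarith

lemma exists_sobolev_const (hn : 0 < n) : ∃ K : ℝ≥0∞, K ≠ ∞ ∧ ∀ g : En n → ℝ, ContDiff ℝ 1 g →
    HasCompactSupport g → ∫⁻ x, ‖g x‖ₑ ^ (1 + (n : ℝ)⁻¹) ≤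
      K * ((∫⁻ x, ‖g x‖ₑ) + ∫⁻ x, ‖fderiv ℝ g x‖ₑ) ^ (1 + (n : ℝ)⁻¹) := by
  have hn' : (0 : ℝ) < n := by exact_mod_cast hn
  set p : ℝ := 1 + (n : ℝ)⁻¹ with hp
  have hp0 : 0 < p := by positivity
  let η : ContDiffBump (0 : ℝ) := ⟨1, 2, one_pos, one_lt_two⟩
  have hη : ContDiff ℝ 1 η := η.contDiff
  have hηc : HasCompactSupport η := η.hasCompactSupport
  have hηm := hη.continuous
  have hηd := hη.continuous_fderiv one_ne_zero
  set A : ℝ≥0∞ := ∫⁻ y, ‖η y‖ₑ ^ p with hA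
  set B : ℝ≥0∞ := (∫⁻ y, ‖η y‖ₑ) + ∫⁻ y, ‖fderiv ℝ η y‖ₑ with hB
  have hA0 : A ≠ 0 := by
    have h1 : (1 : ℝ≥0∞) ≤ A := by
      calc (1 : ℝ≥0∞) ≤ ∫⁻ y in Metric.closedBall (0 : ℝ) 1, 1 := by
            simp
        _ ≤ ∫⁻ y in Metric.closedBall (0 : ℝ) 1, ‖η y‖ₑ ^ p := by
            refine setLIntegral_mono' Metric.isClosed_closedBall.measurableSet fun y hy => ?_
            rw [η.one_of_mem_closedBall hy]
            simp
        _ ≤ A := setLIntegral_le_lintegral _ _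
    exact (zero_lt_one.trans_le h1).ne'
  have hBt : B ≠ ∞ := by
    have h1 := (hηm.integrable_of_hasCompactSupport (μ := volume) hηc).hasFiniteIntegral
    have h2 := (hηd.integrable_of_hasCompactSupport (μ := volume)
      (hηc.fderiv (𝕜 := ℝ))).hasFiniteIntegral
    exact ENNReal.add_ne_top.2 ⟨h1.ne, h2.ne⟩
  set C := lintegralPowLePowLIntegralFDerivConst
    ((volume : Measure (En n)).prod (volume : Measure ℝ)) p
  refine ⟨A⁻¹ * (C * B ^ p), ENNReal.mul_ne_top (ENNReal.inv_ne_top.2 hA0)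
    (ENNReal.mul_ne_top ENNReal.coe_ne_top (ENNReal.rpow_ne_top_of_nonneg hp0.le hBt)), ?_⟩
  intro g hg hgc
  have hgm := hg.continuous
  have hgd := hg.continuous_fderiv one_ne_zero
  have hG : ContDiff ℝ 1 (fun z : En n × ℝ => g z.1 * η z.2) :=
    (hg.comp contDiff_fst).mul (hη.comp contDiff_snd)
  have hGc : HasCompactSupport (fun z : En n × ℝ => g z.1 * η z.2) := by
    refine HasCompactSupport.intro (hgc.prod hηc) fun z hz => ?_
    rw [Set.mem_prod, not_and_or] at hz
    rcases hz with h | h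
    · simp [image_eq_zero_of_notMem_tsupport h]
    · simp [image_eq_zero_of_notMem_tsupport h]
  have hconj : Real.HolderConjugate (Module.finrank ℝ (En n × ℝ)) p := by
    rw [Real.holderConjugate_iff]
    simp only [Module.finrank_prod, finrank_euclideanSpace, Fintype.card_fin, Module.finrank_self]
    push_cast
    refine ⟨by linarith, ?_⟩
    rw [hp]
    field_simp
    ring
  have key := lintegral_pow_le_pow_lintegral_fderiv
    ((volume : Measure (En n)).prod (volume : Measure ℝ)) hG hGc hconj
  have hl : ∫⁻ z, ‖g z.1 * η z.2‖ₑ ^ p ∂((volume : Measure (En n)).prod (volume : Measure ℝ)) =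
      (∫⁻ x, ‖g x‖ₑ ^ p) * A := by
    simp only [enorm_mul, ENNReal.mul_rpow_of_nonneg _ _ hp0.le]
    exact lintegral_prod_mul (f := fun x => ‖g x‖ₑ ^ p) (g := fun y => ‖η y‖ₑ ^ p)
      (by fun_prop) (by fun_prop)
  have hfd : ∀ z : En n × ℝ, ‖fderiv ℝ (fun z : En n × ℝ => g z.1 * η z.2) z‖ₑ ≤
      ‖g z.1‖ₑ * ‖fderiv ℝ η z.2‖ₑ + ‖fderiv ℝ g z.1‖ₑ * ‖η z.2‖ₑ := by
    intro z
    have h1 := ((hg.differentiable one_ne_zero z.1).hasFDerivAt.comp z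
      (ContinuousLinearMap.fst ℝ (En n) ℝ).hasFDerivAt)
    have h2 := ((hη.differentiable one_ne_zero z.2).hasFDerivAt.comp z
      (ContinuousLinearMap.snd ℝ (En n) ℝ).hasFDerivAt)
    have h3 := (h1.fun_mul h2).fderiv
    simp only [Function.comp_apply] at h3
    rw [h3]
    have h4 : ‖(fderiv ℝ η z.2).comp (ContinuousLinearMap.snd ℝ (En n) ℝ)‖ₑ ≤
        ‖fderiv ℝ η z.2‖ₑ := by
      rw [enorm_le_iff_norm_le]
      refine (ContinuousLinearMap.opNorm_comp_le _ _).trans ?_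
      exact mul_le_of_le_one_right (norm_nonneg _) (ContinuousLinearMap.norm_snd_le ..)
    have h5 : ‖(fderiv ℝ g z.1).comp (ContinuousLinearMap.fst ℝ (En n) ℝ)‖ₑ ≤
        ‖fderiv ℝ g z.1‖ₑ := by
      rw [enorm_le_iff_norm_le]
      refine (ContinuousLinearMap.opNorm_comp_le _ _).trans ?_
      exact mul_le_of_le_one_right (norm_nonneg _) (ContinuousLinearMap.norm_fst_le ..)
    refine (enorm_add_le (E := En n × ℝ →L[ℝ] ℝ) _ _).trans ?_
    rw [enorm_smul, enorm_smul, mul_comm (‖fderiv ℝ g z.1‖ₑ)]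
    gcongr
  have hr : ∫⁻ z, ‖fderiv ℝ (fun z : En n × ℝ => g z.1 * η z.2) z‖ₑ
      ∂((volume : Measure (En n)).prod (volume : Measure ℝ)) ≤
      ((∫⁻ x, ‖g x‖ₑ) + ∫⁻ x, ‖fderiv ℝ g x‖ₑ) * B := by
    refine (lintegral_mono hfd).trans ?_
    rw [lintegral_add_left (by fun_prop), lintegral_prod_mul (f := fun x => ‖g x‖ₑ)
      (g := fun y => ‖fderiv ℝ η y‖ₑ) (by fun_prop) (by fun_prop),
      lintegral_prod_mul (f := fun x => ‖fderiv ℝ g x‖ₑ)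
      (g := fun y => ‖η y‖ₑ) (by fun_prop) (by fun_prop), add_mul, hB]
    gcongr
    · exact le_add_self
    · exact le_self_add
  rw [hl] at key
  have hAt : A ≠ ∞ := by
    have hc : Continuous (fun y => ‖η y‖ ^ p) := by
      exact hηm.norm.rpow_const fun y => Or.inr hp0.le
    have h1 := (hc.integrable_of_hasCompactSupport (μ := volume)
      (hηc.comp_left (g := fun t : ℝ => ‖t‖ ^ p) (by simp [hp0.ne']))).hasFiniteIntegral
    rw [hA]
    convert h1.ne using 3 with y
    rw [Real.enorm_rpow_of_nonneg (norm_nonneg _) hp0.le, enorm_norm]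
  calc ∫⁻ x, ‖g x‖ₑ ^ p = A⁻¹ * ((∫⁻ x, ‖g x‖ₑ ^ p) * A) := by
        rw [mul_comm _ A, ← mul_assoc, ENNReal.inv_mul_cancel hA0 hAt, one_mul]
    _ ≤ A⁻¹ * (C * (((∫⁻ x, ‖g x‖ₑ) + ∫⁻ x, ‖fderiv ℝ g x‖ₑ) * B) ^ p) := by
        exact mul_le_mul' le_rfl (key.trans (mul_le_mul' le_rfl (ENNReal.rpow_le_rpow hr hp0.le)))
    _ = _ := by
        rw [ENNReal.mul_rpow_of_nonneg _ _ hp0.le]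
        ring

lemma exists_sobolev_const_real (hn : 0 < n) : ∃ K : ℝ, 0 ≤ K ∧ ∀ g : En n → ℝ, ContDiff ℝ 1 g →
    HasCompactSupport g → (∀ x, 0 ≤ g x) → ∫ x, g x ^ (1 + (n : ℝ)⁻¹) ≤
      K * ((∫ x, g x) + ∫ x, ‖fderiv ℝ g x‖) ^ (1 + (n : ℝ)⁻¹) := by
  obtain ⟨K, hK, h⟩ := exists_sobolev_const hn
  refine ⟨K.toReal, ENNReal.toReal_nonneg, fun g hg hgc hg0 => ?_⟩
  have hp0 : (0 : ℝ) < 1 + (n : ℝ)⁻¹ := by positivity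
  have hgi := hg.continuous.integrable_of_hasCompactSupport (μ := volume) hgc
  have hdi := (hg.continuous_fderiv one_ne_zero).integrable_of_hasCompactSupport (μ := volume)
    (hgc.fderiv (𝕜 := ℝ))
  have h1 : ∫⁻ x, ‖g x‖ₑ = ENNReal.ofReal (∫ x, g x) := by
    rw [← ofReal_integral_norm_eq_lintegral_enorm hgi]
    simp only [Real.norm_of_nonneg (hg0 _)]
  have h2 := ofReal_integral_norm_eq_lintegral_enorm hdi
  have h3 := h g hg hgc
  have hN : 0 ≤ ∫ x, g x := integral_nonneg hg0
  have hS : 0 ≤ ∫ x, ‖fderiv ℝ g x‖ := integral_nonneg fun x => norm_nonneg _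
  rw [h1, ← h2, ← ENNReal.ofReal_add hN hS, ENNReal.ofReal_rpow_of_nonneg (by positivity) hp0.le]
    at h3
  have h4 := ENNReal.toReal_mono (ENNReal.mul_ne_top hK ENNReal.ofReal_ne_top) h3
  rw [ENNReal.toReal_mul, ENNReal.toReal_ofReal (by positivity)] at h4
  refine le_trans (le_of_eq ?_) h4
  rw [integral_eq_lintegral_of_nonneg_ae (ae_of_all _ fun x => Real.rpow_nonneg (hg0 x) _)]
  · congr 2 with x
    rw [← ENNReal.ofReal_rpow_of_nonneg (hg0 x) hp0.le, Real.enorm_of_nonneg (hg0 x)]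
  · exact (hg.continuous.rpow_const fun y => Or.inr hp0.le).aestronglyMeasurable

lemma log_one_add_le_rpow (hn : 0 < n) {u l : ℝ} (hu : 0 ≤ u) (hl : 1 ≤ l) :
    log (1 + u) ≤ n * (log l + u ^ ((n : ℝ)⁻¹) / l) := by
  have hn' : (1 : ℝ) ≤ n := by exact_mod_cast hn
  have hn0 : (0 : ℝ) < n := by linarith
  have h1 : (1 + u) ^ ((n : ℝ)⁻¹) ≤ 1 + u ^ ((n : ℝ)⁻¹) := by
    simpa using Real.rpow_add_le_add_rpow zero_le_one hu (by positivity) (inv_le_one_of_one_le₀ hn')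
  have hl0 : 0 < l := by linarith
  have hy : 0 < (1 + u) ^ ((n : ℝ)⁻¹) := by positivity
  have h2 : log (1 + u) = n * log ((1 + u) ^ ((n : ℝ)⁻¹)) := by
    rw [Real.log_rpow (by positivity)]
    field_simp
  have h3 : log ((1 + u) ^ ((n : ℝ)⁻¹)) = log l + log ((1 + u) ^ ((n : ℝ)⁻¹) / l) := by
    rw [Real.log_div hy.ne' hl0.ne']
    ring
  have h4 := Real.log_le_sub_one_of_pos (div_pos hy hl0)
  have h5 : (1 + u) ^ ((n : ℝ)⁻¹) / l ≤ 1 + u ^ ((n : ℝ)⁻¹) / l := by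
    calc _ ≤ (1 + u ^ ((n : ℝ)⁻¹)) / l := by gcongr
      _ = 1 / l + u ^ ((n : ℝ)⁻¹) / l := add_div _ _ _
      _ ≤ _ := by
        gcongr
        exact div_le_one_of_le₀ hl hl0.le
  rw [h2, h3]
  gcongr
  linarith

lemma exists_integral_mul_log_one_add_le (hn : 0 < n) : ∃ A : ℝ, 0 ≤ A ∧ ∀ g : En n → ℝ,
    ContDiff ℝ 1 g → HasCompactSupport g → (∀ x, 0 ≤ g x) → ∀ s, 0 < s → ∫ x, g x ≤ s →
      ∫ x, g x * log (1 + g x / s) ≤ A * (s + ∫ x, ‖fderiv ℝ g x‖) := by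
  obtain ⟨K, hK0, hK⟩ := exists_sobolev_const_real hn
  have hn0 : (0 : ℝ) < n := by exact_mod_cast hn
  set p : ℝ := 1 + (n : ℝ)⁻¹ with hp
  have hp0 : 0 < p := by positivity
  refine ⟨n * (p + K), by positivity, fun g hg hgc hg0 s hs hgs => ?_⟩
  set S := ∫ x, ‖fderiv ℝ g x‖ with hS
  have hS0 : 0 ≤ S := integral_nonneg fun x => norm_nonneg _
  set l : ℝ := (1 + S / s) ^ p with hl
  have hl1 : 1 ≤ l := Real.one_le_rpow (by linarith [div_nonneg hS0 hs.le]) hp0.le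
  have hl0 : 0 < l := by linarith
  have hgm := hg.continuous
  have hi1 : Integrable (fun x => g x) := hgm.integrable_of_hasCompactSupport hgc
  have hi2 : Integrable (fun x => g x ^ p) :=
    (hgm.rpow_const fun y => Or.inr hp0.le).integrable_of_hasCompactSupport
      (hgc.comp_left (g := fun t : ℝ => t ^ p) (by simp [hp0.ne']))
  have hi3 : Integrable (fun x => g x * log (1 + g x / s)) := by
    refine Continuous.integrable_of_hasCompactSupport ?_ hgc.mul_right
    refine hgm.mul (Continuous.log (by fun_prop) fun x => ?_)
    have := div_nonneg (hg0 x) hs.le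
    positivity
  have hpt : ∀ x, g x * log (1 + g x / s) ≤
      n * log l * g x + n * (s ^ ((n : ℝ)⁻¹) * l)⁻¹ * g x ^ p := by
    intro x
    have h1 := mul_le_mul_of_nonneg_left
      (log_one_add_le_rpow hn (div_nonneg (hg0 x) hs.le) hl1) (hg0 x)
    refine h1.trans (le_of_eq ?_)
    rw [hp, Real.rpow_one_add' (hg0 x) (by positivity), Real.div_rpow (hg0 x) hs.le]
    field_simp
  have h2 := integral_mono hi3 ((hi1.const_mul _).add (hi2.const_mul _)) hpt
  simp only [Pi.add_apply] at h2
  rw [integral_add (hi1.const_mul _) (hi2.const_mul _), integral_const_mul, integral_const_mul]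
    at h2
  have h3 : ∫ x, g x ^ p ≤ K * (s ^ p * l) := by
    refine (hK g hg hgc hg0).trans ?_
    rw [hl, ← Real.mul_rpow hs.le (by positivity)]
    have : s * (1 + S / s) = s + S := by field_simp
    rw [this]
    have hN : 0 ≤ ∫ x, g x := integral_nonneg hg0
    gcongr
  have h4 : log l ≤ p * (S / s) := by
    rw [hl, Real.log_rpow (by positivity)]
    have := Real.log_le_sub_one_of_pos (show 0 < 1 + S / s by positivity)
    gcongr
    linarith
  have hsp : s ^ p = s * s ^ ((n : ℝ)⁻¹) := by
    rw [hp, Real.rpow_one_add' hs.le (by positivity)]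
  have h0 : 0 ≤ log l := Real.log_nonneg hl1
  have hN : 0 ≤ ∫ x, g x := integral_nonneg hg0
  calc _ ≤ _ := h2
    _ ≤ n * (p * (S / s)) * s + n * (s ^ ((n : ℝ)⁻¹) * l)⁻¹ * (K * (s ^ p * l)) := by
        gcongr
    _ = n * p * S + n * K * s := by
        rw [hsp]
        field_simp
    _ ≤ _ := by
        have : 0 ≤ n * p * s + n * K * S := by positivity
        linarith

lemma exists_abs_add_norm_fderiv_le {V : En n → ℝ} (hV : ContDiff ℝ 2 V) {δ : ℝ}
    (hHess : ∀ x v : En n, δ * ‖v‖ ^ 2 ≤ iteratedFDeriv ℝ 2 V x ![v, v]) (x₀ : En n) :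
    ∃ K : ℝ, 0 ≤ K ∧ ∀ y, |V y| + ‖fderiv ℝ V y‖ ≤
      K * (1 + ‖y - x₀‖ ^ 2) + fderiv ℝ V y (y - x₀) := by
  obtain ⟨C₀, hC₀⟩ := (isCompact_closedBall x₀ (1 : ℝ)).exists_bound_of_continuousOn
    hV.continuous.continuousOn
  have hC0 : 0 ≤ C₀ := (norm_nonneg _).trans (hC₀ x₀ (by simp))
  refine ⟨C₀ + |δ| + 2 * (|V x₀| + ‖fderiv ℝ V x₀‖ + |δ|), by positivity, fun y => ?_⟩
  set r := ‖y - x₀‖ with hr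
  have hr0 : 0 ≤ r := norm_nonneg _
  set g := gradient V y with hg
  set z := x₀ + (‖g‖⁻¹ : ℝ) • g with hz
  have hgn : ‖(‖g‖⁻¹ : ℝ) • g‖ ≤ 1 := by
    rw [norm_smul, norm_inv, norm_norm]
    exact inv_mul_le_one
  have hVz : V z ≤ C₀ := (le_abs_self _).trans (hC₀ z (by simpa [hz] using hgn))
  have h1 := le_of_le_iteratedFDeriv_two hV hHess y z
  have h2 : fderiv ℝ V y (z - y) = ‖fderiv ℝ V y‖ - fderiv ℝ V y (y - x₀) := by
    have e1 : z - y = (‖g‖⁻¹ : ℝ) • g - (y - x₀) := by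
      rw [hz]
      abel
    rw [e1, map_sub, map_smul, ← inner_gradient_eq_fderiv, real_inner_self_eq_norm_sq,
      ← norm_gradient_eq, ← hg, smul_eq_mul]
    by_cases h0 : ‖g‖ = 0
    · simp [h0]
    · field_simp
  have h3 : ‖z - y‖ ≤ 1 + r := by
    have e1 : z - y = (‖g‖⁻¹ : ℝ) • g - (y - x₀) := by
      rw [hz]
      abel
    rw [e1]
    exact (norm_sub_le _ _).trans (by linarith)
  have h4 : ‖z - y‖ ^ 2 ≤ 2 * (1 + r ^ 2) := by
    nlinarith [norm_nonneg (z - y), sq_nonneg (1 - r)]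
  have h5 : -(|δ| * (1 + r ^ 2)) ≤ δ / 2 * ‖z - y‖ ^ 2 := by
    nlinarith [neg_abs_le δ, abs_nonneg δ, sq_nonneg ‖z - y‖]
  have h6 := le_of_le_iteratedFDeriv_two hV hHess x₀ y
  have h7 : -(‖fderiv ℝ V x₀‖ * r) ≤ fderiv ℝ V x₀ (y - x₀) :=
    (abs_le.1 ((fderiv ℝ V x₀).le_opNorm (y - x₀))).1
  have h8 : -((|V x₀| + ‖fderiv ℝ V x₀‖ + |δ|) * (1 + r ^ 2)) ≤ V y := by
    have a1 : r ≤ 1 + r ^ 2 := by nlinarith [sq_nonneg (r - 1)]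
    have a2 := mul_le_mul_of_nonneg_left a1 (norm_nonneg (fderiv ℝ V x₀))
    have a3 : -(|δ| * (1 + r ^ 2)) ≤ δ / 2 * r ^ 2 := by
      nlinarith [neg_abs_le δ, abs_nonneg δ, sq_nonneg r]
    have a4 : -(|V x₀| * (1 + r ^ 2)) ≤ V x₀ := by
      nlinarith [neg_abs_le (V x₀), mul_nonneg (abs_nonneg (V x₀)) (sq_nonneg r)]
    linarith
  have h9 : |V y| ≤ V y + 2 * ((|V x₀| + ‖fderiv ℝ V x₀‖ + |δ|) * (1 + r ^ 2)) := by
    have : 0 ≤ (|V x₀| + ‖fderiv ℝ V x₀‖ + |δ|) * (1 + r ^ 2) := by positivity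
    rw [abs_le]
    constructor <;> linarith
  have h10 : C₀ ≤ C₀ * (1 + r ^ 2) := le_mul_of_one_le_right hC0 (by nlinarith)
  linarith

lemma integral_abs_add_norm_fderiv_mul_sq_le {V φ : En n → ℝ} (hV : ContDiff ℝ 2 V) {x₀ : En n}
    {K : ℝ} (hK : ∀ y, |V y| + ‖fderiv ℝ V y‖ ≤
      K * (1 + ‖y - x₀‖ ^ 2) + fderiv ℝ V y (y - x₀))
    (hφ : ContDiff ℝ 1 φ) (hcφ : HasCompactSupport φ) :
    ∫ x, φ x ^ 2 * (|V x| + ‖fderiv ℝ V x‖) * exp (-V x) ≤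
      (K + n) * (∫ x, φ x ^ 2 * exp (-V x)) + (K + 1) * (∫ x, φ x ^ 2 * ‖x - x₀‖ ^ 2 * exp (-V x))
        + ∫ x, ‖fderiv ℝ φ x‖ ^ 2 * exp (-V x) := by
  have hV1 : ContDiff ℝ 1 V := hV.of_le (by norm_num)
  have hVc := hV.continuous
  have hVd := hV1.continuous_fderiv one_ne_zero
  have hφc := hφ.continuous
  have hφd := hφ.continuous_fderiv one_ne_zero
  have hI1 : Integrable (fun x => φ x ^ 2 * ‖x - x₀‖ ^ 2 * exp (-V x)) :=
    Continuous.integrable_of_hasCompactSupport (by fun_prop) hcφ.sq.mul_right.mul_right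
  have hI2 : Integrable (fun x => φ x ^ 2 * exp (-V x)) :=
    Continuous.integrable_of_hasCompactSupport (by fun_prop) hcφ.sq.mul_right
  have hI3 : Integrable (fun x => ‖fderiv ℝ φ x‖ ^ 2 * exp (-V x)) :=
    Continuous.integrable_of_hasCompactSupport (by fun_prop) hcφ.norm_fderiv_sq.mul_right
  have hI4 : Integrable (fun x => φ x ^ 2 * (|V x| + ‖fderiv ℝ V x‖) * exp (-V x)) :=
    Continuous.integrable_of_hasCompactSupport (by fun_prop) hcφ.sq.mul_right.mul_right
  have hI5 : Integrable (fun x => φ x ^ 2 * (n - fderiv ℝ V x (x - x₀)) * exp (-V x)) :=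
    Continuous.integrable_of_hasCompactSupport (by fun_prop) hcφ.sq.mul_right.mul_right
  have hI6 : Integrable (fun x => 2 * φ x * fderiv ℝ φ x (x - x₀) * exp (-V x)) :=
    Continuous.integrable_of_hasCompactSupport (by fun_prop)
      hcφ.mul_left.mul_right.mul_right
  have h1 := integral_sq_mul_fderiv_radial_eq V φ hV1 hφ hcφ x₀
  have h2 : ∫ x, φ x ^ 2 * (|V x| + ‖fderiv ℝ V x‖) * exp (-V x) ≤
      ∫ x, ((K + n) * (φ x ^ 2 * exp (-V x)) + K * (φ x ^ 2 * ‖x - x₀‖ ^ 2 * exp (-V x))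
        - φ x ^ 2 * (n - fderiv ℝ V x (x - x₀)) * exp (-V x)) := by
    refine integral_mono hI4 (((hI2.const_mul _).add (hI1.const_mul _)).sub hI5) fun x => ?_
    have := mul_le_mul_of_nonneg_left (hK x)
      (mul_nonneg (sq_nonneg (φ x)) (exp_pos (-V x)).le)
    linarith
  rw [integral_sub ((hI2.const_mul _).fun_add (hI1.const_mul _)) hI5,
    integral_add (hI2.const_mul _) (hI1.const_mul _), integral_const_mul, integral_const_mul,
    h1, sub_neg_eq_add] at h2
  have h3 : ∫ x, 2 * φ x * fderiv ℝ φ x (x - x₀) * exp (-V x) ≤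
      ∫ x, (‖fderiv ℝ φ x‖ ^ 2 * exp (-V x) + φ x ^ 2 * ‖x - x₀‖ ^ 2 * exp (-V x)) := by
    refine integral_mono hI6 (hI3.add hI1) fun x => ?_
    have e : 2 * φ x * fderiv ℝ φ x (x - x₀) ≤ ‖fderiv ℝ φ x‖ ^ 2 + φ x ^ 2 * ‖x - x₀‖ ^ 2 := by
      have a1 : |φ x * fderiv ℝ φ x (x - x₀)| ≤ |φ x| * (‖fderiv ℝ φ x‖ * ‖x - x₀‖) := by
        rw [abs_mul]
        exact mul_le_mul_of_nonneg_left ((fderiv ℝ φ x).le_opNorm _) (abs_nonneg _)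
      have a2 := le_abs_self (φ x * fderiv ℝ φ x (x - x₀))
      have a3 : φ x ^ 2 = |φ x| ^ 2 := (sq_abs _).symm
      rw [a3]
      nlinarith [sq_nonneg (‖fderiv ℝ φ x‖ - |φ x| * ‖x - x₀‖)]
    have := mul_le_mul_of_nonneg_right e (exp_pos (-V x)).le
    simp only
    linarith
  rw [integral_add hI3 hI1] at h3
  linarith

/-- The defective logarithmic Sobolev inequality, with the entropy taken at a free level `s`. -/
lemma exists_integral_sq_mul_log_le (hn : 0 < n) {V W : En n → ℝ} (hV : ContDiff ℝ 2 V)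
    (hW : ContDiff ℝ 2 W) (hW1 : ∀ x, 1 ≤ W x) {x₀ : En n} {b c : ℝ} (hb : 0 < b) (hc : 0 < c)
    (hLyap : ∀ x, Lop V W x ≤ (-c * ‖x - x₀‖ ^ 2 + b) * W x) {δ : ℝ}
    (hHess : ∀ x v : En n, δ * ‖v‖ ^ 2 ≤ iteratedFDeriv ℝ 2 V x ![v, v]) :
    ∃ A : ℝ, 0 ≤ A ∧ ∀ φ : En n → ℝ, ContDiff ℝ 1 φ → HasCompactSupport φ → ∀ s, 0 < s →
      ∫ x, φ x ^ 2 * exp (-V x) ≤ s →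
      ∫ x, φ x ^ 2 * log (1 + φ x ^ 2 / s) * exp (-V x) ≤
        A * (s + ∫ x, ‖fderiv ℝ φ x‖ ^ 2 * exp (-V x)) := by
  obtain ⟨K, hK0, hK⟩ := exists_abs_add_norm_fderiv_le hV hHess x₀
  obtain ⟨A, hA0, hA⟩ := exists_integral_mul_log_one_add_le hn
  set Q : ℝ := K + n + (K + 1) * ((1 + b) / c) + 1 with hQ
  have hQ0 : 0 ≤ Q := by positivity
  refine ⟨2 * A + (A + 1) * Q, by positivity, fun φ hφ hcφ s hs hNs => ?_⟩
  have hV1 : ContDiff ℝ 1 V := hV.of_le (by norm_num)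
  have hVc := hV.continuous
  have hVd := hV1.continuous_fderiv one_ne_zero
  have hφc := hφ.continuous
  have hφd := hφ.continuous_fderiv one_ne_zero
  have hI2 : Integrable (fun x => φ x ^ 2 * exp (-V x)) :=
    Continuous.integrable_of_hasCompactSupport (by fun_prop) hcφ.sq.mul_right
  have hI3 : Integrable (fun x => ‖fderiv ℝ φ x‖ ^ 2 * exp (-V x)) :=
    Continuous.integrable_of_hasCompactSupport (by fun_prop) hcφ.norm_fderiv_sq.mul_right
  have hI4 : Integrable (fun x => φ x ^ 2 * (|V x| + ‖fderiv ℝ V x‖) * exp (-V x)) :=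
    Continuous.integrable_of_hasCompactSupport (by fun_prop) hcφ.sq.mul_right.mul_right
  have hM := integral_norm_sub_sq_mul_sq_le_of_lyapunov hV hW hW1 hLyap hφ hcφ
  have hT := integral_abs_add_norm_fderiv_mul_sq_le hV hK hφ hcφ
  have hg : ContDiff ℝ 1 (fun x => φ x ^ 2 * exp (-V x)) := by fun_prop
  have hgc : HasCompactSupport (fun x => φ x ^ 2 * exp (-V x)) := hcφ.sq.mul_right
  have hg0 : ∀ x, 0 ≤ φ x ^ 2 * exp (-V x) := fun x => by positivity
  have hL := hA _ hg hgc hg0 s hs hNs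
  set N := ∫ x, φ x ^ 2 * exp (-V x)
  set I := ∫ x, ‖fderiv ℝ φ x‖ ^ 2 * exp (-V x)
  set M := ∫ x, φ x ^ 2 * ‖x - x₀‖ ^ 2 * exp (-V x)
  set T := ∫ x, φ x ^ 2 * (|V x| + ‖fderiv ℝ V x‖) * exp (-V x)
  have hN0 : 0 ≤ N := integral_nonneg hg0
  have hI0 : 0 ≤ I := integral_nonneg fun x => by positivity
  have hM' : M ≤ (1 + b) / c * (s + I) := by
    rw [div_mul_eq_mul_div, le_div_iff₀ hc]
    nlinarith
  have hT' : T ≤ Q * (s + I) := by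
    have h1 : (K + n) * N ≤ (K + n) * (s + I) := by gcongr; linarith
    have h2 : (K + 1) * M ≤ (K + 1) * ((1 + b) / c * (s + I)) := by gcongr
    rw [hQ]
    linarith
  have hdg : ∀ x, ‖fderiv ℝ (fun x => φ x ^ 2 * exp (-V x)) x‖ ≤ φ x ^ 2 * exp (-V x) +
      ‖fderiv ℝ φ x‖ ^ 2 * exp (-V x) + φ x ^ 2 * (|V x| + ‖fderiv ℝ V x‖) * exp (-V x) := by
    intro x
    have h1 := ((hφ.differentiable one_ne_zero x).hasFDerivAt.pow 2).fun_mul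
      (hV1.differentiable one_ne_zero x).hasFDerivAt.fun_neg.exp
    rw [h1.fderiv]
    refine (norm_add_le _ _).trans ?_
    simp only [norm_smul, norm_neg, norm_pow, Real.norm_eq_abs, abs_exp, sq_abs]
    norm_num
    have h2 : 2 * |φ x| * ‖fderiv ℝ φ x‖ ≤ φ x ^ 2 + ‖fderiv ℝ φ x‖ ^ 2 := by
      rw [← sq_abs (φ x)]
      exact two_mul_le_add_sq _ _
    have h3 : 0 ≤ φ x ^ 2 * |V x| := by positivity
    have h4 := exp_pos (-V x)
    nlinarith
  have hS : ∫ x, ‖fderiv ℝ (fun x => φ x ^ 2 * exp (-V x)) x‖ ≤ N + I + T := by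
    rw [← integral_add hI2 hI3, ← integral_add (hI2.fun_add hI3) hI4]
    refine integral_mono ?_ ((hI2.add hI3).add hI4) hdg
    exact ((hg.continuous_fderiv one_ne_zero).integrable_of_hasCompactSupport
      (hgc.fderiv (𝕜 := ℝ))).norm
  have hlogc : ∀ ψ : En n → ℝ, Continuous ψ → (∀ x, 0 ≤ ψ x) →
      Continuous fun x => log (1 + ψ x / s) := fun ψ h h0 => by
    refine Continuous.log (by fun_prop) fun x => ?_
    have := div_nonneg (h0 x) hs.le
    positivity
  have hfin : ∫ x, φ x ^ 2 * log (1 + φ x ^ 2 / s) * exp (-V x) ≤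
      ∫ x, (φ x ^ 2 * exp (-V x) * log (1 + φ x ^ 2 * exp (-V x) / s) +
        φ x ^ 2 * (|V x| + ‖fderiv ℝ V x‖) * exp (-V x)) := by
    have hc1 := hlogc (fun x => φ x ^ 2) (hφc.pow 2) fun x => sq_nonneg _
    have hc2 := hlogc _ hg.continuous hg0
    refine integral_mono ?_ (Integrable.add ?_ hI4) fun x => ?_
    · exact Continuous.integrable_of_hasCompactSupport (by fun_prop) hcφ.sq.mul_right.mul_right
    · exact Continuous.integrable_of_hasCompactSupport (by fun_prop) hgc.mul_right
    · have h1 : log (1 + φ x ^ 2 / s) ≤ log (1 + φ x ^ 2 * exp (-V x) / s) + |V x| := by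
        have hp : 0 < 1 + φ x ^ 2 * exp (-V x) / s := by positivity
        rw [← Real.log_exp |V x|, ← Real.log_mul hp.ne' (exp_pos _).ne']
        refine Real.log_le_log (by positivity) ?_
        have a1 : 1 ≤ exp |V x| := Real.one_le_exp (abs_nonneg _)
        have a2 : 1 ≤ exp (-V x) * exp |V x| := by
          rw [← Real.exp_add]
          exact Real.one_le_exp (by linarith [le_abs_self (V x)])
        have a3 : 0 ≤ φ x ^ 2 / s := by positivity
        calc _ ≤ exp |V x| + φ x ^ 2 / s * (exp (-V x) * exp |V x|) :=
              add_le_add a1 (le_mul_of_one_le_right a3 a2)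
          _ = _ := by ring
      have h2 := mul_le_mul_of_nonneg_left h1 (hg0 x)
      have h3 : 0 ≤ φ x ^ 2 * ‖fderiv ℝ V x‖ * exp (-V x) := by positivity
      simp only
      linarith
  rw [integral_add ?_ hI4] at hfin
  · have h1 := mul_le_mul_of_nonneg_left hS hA0
    have h2 : A * T ≤ A * (Q * (s + I)) := by gcongr
    have h3 : A * N ≤ A * s := by gcongr
    have h4 : 0 ≤ A * I := by positivity
    linarith
  · have hc2 := hlogc _ hg.continuous hg0
    exact Continuous.integrable_of_hasCompactSupport (by fun_prop) hgc.mul_right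

lemma lintegral_comp_smul_add_le {G : En n → ℝ≥0∞} (hG : Measurable G) {r : ℝ} (hr : 1 / 2 ≤ r)
    (a : En n) : ∫⁻ x, G (r • x + a) ≤ 2 ^ n * ∫⁻ x, G x := by
  have hr0 : 0 < r := by linarith
  have h1 : ∫⁻ x, G (r • x + a) = ∫⁻ x, G (x + a) ∂(Measure.map (r • ·) volume) := by
    rw [lintegral_map (by fun_prop) (by fun_prop)]
  rw [h1, Measure.map_addHaar_smul _ hr0.ne', lintegral_smul_measure, lintegral_add_right_eq_self,
    finrank_euclideanSpace, Fintype.card_fin, smul_eq_mul]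
  gcongr
  rw [abs_of_pos (by positivity)]
  have h2 : (r ^ n)⁻¹ ≤ 2 ^ n := by
    rw [← inv_pow]
    gcongr
    rw [inv_le_comm₀ hr0 two_pos]
    linarith
  refine (ENNReal.ofReal_le_ofReal h2).trans (le_of_eq ?_)
  rw [ENNReal.ofReal_pow two_pos.le]
  simp

lemma setLIntegral_setLIntegral_segment_le {G : En n → ℝ≥0∞} (hG : Measurable G) (B : Set (En n))
    (t : ℝ) :
    ∫⁻ x in B, ∫⁻ y in B, G (y + t • (x - y)) ≤ 2 ^ n * volume B * ∫⁻ x, G x := by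
  rcases le_total (1 / 2) t with ht | ht
  · rw [lintegral_lintegral_swap (by
      apply Measurable.aemeasurable
      unfold Function.uncurry
      fun_prop)]
    calc _ ≤ ∫⁻ y in B, 2 ^ n * ∫⁻ x, G x := by
          refine lintegral_mono fun y => (setLIntegral_le_lintegral _ _).trans ?_
          refine le_trans (le_of_eq ?_) (lintegral_comp_smul_add_le hG ht ((1 - t) • y))
          congr 1 with x
          congr 1
          module
      _ = _ := by
          rw [setLIntegral_const]
          ring
  · calc _ ≤ ∫⁻ y in B, 2 ^ n * ∫⁻ x, G x := by
          refine lintegral_mono fun x => (setLIntegral_le_lintegral _ _).trans ?_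
          refine le_trans (le_of_eq ?_) (lintegral_comp_smul_add_le hG
            (show 1 / 2 ≤ 1 - t by linarith) (t • x))
          congr 1 with y
          congr 1
          module
      _ = _ := by
          rw [setLIntegral_const]
          ring

lemma sq_sub_le_integral_norm_fderiv {f : En n → ℝ} (hf : ContDiff ℝ 1 f) (x y : En n) :
    (f x - f y) ^ 2 ≤ ‖x - y‖ ^ 2 * ∫ t in (0 : ℝ)..1, ‖fderiv ℝ f (y + t • (x - y))‖ ^ 2 := by
  have hfd := hf.continuous_fderiv one_ne_zero
  have hl : ∀ t : ℝ, HasDerivAt (fun t : ℝ => y + t • (x - y)) (x - y) t := fun t => by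
    simpa using ((hasDerivAt_id t).smul_const (x - y)).const_add y
  have h1 : ∫ t in (0 : ℝ)..1, fderiv ℝ f (y + t • (x - y)) (x - y) = f x - f y := by
    rw [intervalIntegral.integral_eq_sub_of_hasDerivAt (f := fun t : ℝ => f (y + t • (x - y)))
      (fun t _ => (hf.differentiable one_ne_zero _).hasFDerivAt.comp_hasDerivAt t (hl t))]
    · simp
    · exact Continuous.intervalIntegrable (by fun_prop) _ _
  set h : ℝ → ℝ := fun t => fderiv ℝ f (y + t • (x - y)) (x - y) with hh
  have hhc : Continuous h := by fun_prop
  set a := f x - f y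
  have i1 : IntervalIntegrable (fun t => h t ^ 2) volume 0 1 :=
    Continuous.intervalIntegrable (by fun_prop) _ _
  have i2 : IntervalIntegrable (fun t => 2 * a * h t) volume 0 1 :=
    Continuous.intervalIntegrable (by fun_prop) _ _
  have h2 : 0 ≤ ∫ t in (0 : ℝ)..1, (h t - a) ^ 2 :=
    intervalIntegral.integral_nonneg zero_le_one fun t _ => sq_nonneg _
  have h3 : ∫ t in (0 : ℝ)..1, (h t - a) ^ 2 = (∫ t in (0 : ℝ)..1, h t ^ 2) - a ^ 2 := by
    have e : ∀ t, (h t - a) ^ 2 = h t ^ 2 - 2 * a * h t + a ^ 2 := fun t => by ring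
    simp only [e]
    rw [intervalIntegral.integral_add (i1.sub i2) (by simp), intervalIntegral.integral_sub i1 i2,
      intervalIntegral.integral_const_mul, h1]
    simp
    ring
  have h4 : ∫ t in (0 : ℝ)..1, h t ^ 2 ≤
      ∫ t in (0 : ℝ)..1, ‖x - y‖ ^ 2 * ‖fderiv ℝ f (y + t • (x - y))‖ ^ 2 := by
    refine intervalIntegral.integral_mono_on zero_le_one i1
      (Continuous.intervalIntegrable (by fun_prop) _ _) fun t _ => ?_
    rw [← mul_pow, mul_comm, ← sq_abs (h t)]
    gcongr
    exact (fderiv ℝ f (y + t • (x - y))).le_opNorm (x - y)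
  rw [intervalIntegral.integral_const_mul] at h4
  linarith

/-- A Poincaré inequality on balls, centred at a value of the function. -/
lemma exists_setLIntegral_sq_sub_le {f : En n → ℝ} (hf : ContDiff ℝ 1 f) (x₀ : En n) {R : ℝ}
    (hR : 0 < R) :
    ∃ m : ℝ, ∫⁻ x in Metric.closedBall x₀ R, ENNReal.ofReal ((f x - m) ^ 2) ≤
      ENNReal.ofReal (4 * R ^ 2) * 2 ^ n *
        ∫⁻ x in Metric.closedBall x₀ R, ENNReal.ofReal (‖fderiv ℝ f x‖ ^ 2) := by
  set B := Metric.closedBall x₀ R with hB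
  have hfd := hf.continuous_fderiv one_ne_zero
  have hfc := hf.continuous
  have hBm : MeasurableSet B := Metric.isClosed_closedBall.measurableSet
  set G : En n → ℝ≥0∞ := B.indicator fun x => ENNReal.ofReal (‖fderiv ℝ f x‖ ^ 2) with hG
  have hGm : Measurable G := by
    refine Measurable.indicator ?_ hBm
    exact (by fun_prop : Continuous fun x => ‖fderiv ℝ f x‖ ^ 2).measurable.ennreal_ofReal
  have hGi : ∫⁻ x, G x = ∫⁻ x in B, ENNReal.ofReal (‖fderiv ℝ f x‖ ^ 2) := lintegral_indicator hBm _
  have hpt : ∀ x ∈ B, ∀ y ∈ B, ENNReal.ofReal ((f x - f y) ^ 2) ≤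
      ENNReal.ofReal (4 * R ^ 2) * ∫⁻ t in Ioc (0 : ℝ) 1, G (y + t • (x - y)) := by
    intro x hx y hy
    have h1 : ‖x - y‖ ^ 2 ≤ 4 * R ^ 2 := by
      have a1 : dist x y ≤ 2 * R := (dist_triangle_right x y x₀).trans (by
        have b1 := Metric.mem_closedBall.1 hx
        have b2 := Metric.mem_closedBall.1 hy
        linarith)
      rw [dist_eq_norm] at a1
      nlinarith [norm_nonneg (x - y)]
    have h2 : 0 ≤ ∫ t in (0 : ℝ)..1, ‖fderiv ℝ f (y + t • (x - y))‖ ^ 2 :=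
      intervalIntegral.integral_nonneg zero_le_one fun t _ => sq_nonneg _
    have h3 := (sq_sub_le_integral_norm_fderiv hf x y).trans (mul_le_mul_of_nonneg_right h1 h2)
    refine (ENNReal.ofReal_le_ofReal h3).trans ?_
    rw [ENNReal.ofReal_mul (by positivity)]
    gcongr
    rw [intervalIntegral.integral_of_le zero_le_one, ofReal_integral_eq_lintegral_ofReal]
    · refine setLIntegral_mono' measurableSet_Ioc fun t ht => ?_
      have hmem : y + t • (x - y) ∈ B :=
        (convex_closedBall x₀ R).add_smul_sub_mem hy hx ⟨ht.1.le, ht.2⟩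
      rw [hG, indicator_of_mem hmem]
    · exact (Continuous.integrableOn_Icc (by fun_prop)).mono_set Ioc_subset_Icc_self
    · exact ae_of_all _ fun t => sq_nonneg _
  have hcomb : ∫⁻ y in B, ∫⁻ x in B, ENNReal.ofReal ((f x - f y) ^ 2) ≤
      ENNReal.ofReal (4 * R ^ 2) * (2 ^ n * volume B * ∫⁻ x, G x) := by
    calc _ ≤ ∫⁻ y in B, ∫⁻ x in B, ENNReal.ofReal (4 * R ^ 2) *
            ∫⁻ t in Ioc (0 : ℝ) 1, G (y + t • (x - y)) :=
          setLIntegral_mono' hBm fun y hy => setLIntegral_mono' hBm fun x hx => hpt x hx y hy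
      _ = ENNReal.ofReal (4 * R ^ 2) * ∫⁻ y in B, ∫⁻ x in B,
            ∫⁻ t in Ioc (0 : ℝ) 1, G (y + t • (x - y)) := by
          simp only [lintegral_const_mul' _ _ ENNReal.ofReal_ne_top]
      _ = ENNReal.ofReal (4 * R ^ 2) * ∫⁻ t in Ioc (0 : ℝ) 1, ∫⁻ y in B, ∫⁻ x in B,
            G (y + t • (x - y)) := by
          congr 1
          calc _ = ∫⁻ y in B, ∫⁻ t in Ioc (0 : ℝ) 1, ∫⁻ x in B, G (y + t • (x - y)) := by
                refine lintegral_congr fun y => lintegral_lintegral_swap ?_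
                apply Measurable.aemeasurable
                unfold Function.uncurry
                fun_prop
            _ = _ := by
                refine lintegral_lintegral_swap ?_
                apply Measurable.aemeasurable
                unfold Function.uncurry
                refine Measurable.lintegral_prod_right' (f := fun z : (En n × ℝ) × En n =>
                  G (z.1.1 + z.1.2 • (z.2 - z.1.1))) ?_
                fun_prop
      _ ≤ ENNReal.ofReal (4 * R ^ 2) * ∫⁻ t in Ioc (0 : ℝ) 1,
            2 ^ n * volume B * ∫⁻ x, G x := by
          gcongr with t
          rw [lintegral_lintegral_swap]
          · exact setLIntegral_setLIntegral_segment_le hGm B t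
          · apply Measurable.aemeasurable
            unfold Function.uncurry
            fun_prop
      _ = _ := by
          rw [setLIntegral_const]
          simp
  have hB0 : volume B ≠ 0 := (Metric.measure_closedBall_pos volume x₀ hR).ne'
  have hBt : volume B ≠ ∞ := measure_closedBall_lt_top.ne
  obtain ⟨y, -, hy⟩ := exists_le_setLAverage hB0 hBt
    (f := fun y => ∫⁻ x in B, ENNReal.ofReal ((f x - f y) ^ 2)) (by
      apply Measurable.aemeasurable
      refine Measurable.lintegral_prod_right' (f := fun z : En n × En n =>
              ENNReal.ofReal ((f z.2 - f z.1) ^ 2)) ?_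
      exact (by fun_prop : Continuous fun z : En n × En n =>
        (f z.2 - f z.1) ^ 2).measurable.ennreal_ofReal)
  refine ⟨f y, hy.trans ?_⟩
  rw [setLAverage_eq]
  refine ENNReal.div_le_of_le_mul (hcomb.trans (le_of_eq ?_))
  rw [hGi]
  ring

lemma exists_integral_ball_sq_sub_le {V : En n → ℝ} (hV : Continuous V) (x₀ : En n) {R : ℝ}
    (hR : 0 < R) :
    ∃ K : ℝ, 0 ≤ K ∧ ∀ f : En n → ℝ, ContDiff ℝ 1 f → ∃ m : ℝ,
      ∫ x in Metric.closedBall x₀ R, (f x - m) ^ 2 * exp (-V x) ≤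
        K * ∫ x in Metric.closedBall x₀ R, ‖fderiv ℝ f x‖ ^ 2 * exp (-V x) := by
  set B := Metric.closedBall x₀ R with hB
  have hBc : IsCompact B := isCompact_closedBall x₀ R
  have hBm : MeasurableSet B := Metric.isClosed_closedBall.measurableSet
  obtain ⟨C, hC⟩ := hBc.exists_bound_of_continuousOn hV.continuousOn
  set P : ℝ := 4 * R ^ 2 * 2 ^ n with hP
  have hP0 : 0 ≤ P := by positivity
  refine ⟨exp C * P * exp C, by positivity, fun f hf => ?_⟩
  obtain ⟨m, hm⟩ := exists_setLIntegral_sq_sub_le hf x₀ hR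
  refine ⟨m, ?_⟩
  have hfc := hf.continuous
  have hfd := hf.continuous_fderiv one_ne_zero
  have hi : ∀ g : En n → ℝ, Continuous g → IntegrableOn g B := fun g hg =>
    hg.continuousOn.integrableOn_compact hBc
  rw [← ofReal_integral_eq_lintegral_ofReal (hi _ (by fun_prop)) (ae_of_all _ fun x => sq_nonneg _),
    ← ofReal_integral_eq_lintegral_ofReal (hi _ (by fun_prop)) (ae_of_all _ fun x => sq_nonneg _),
    show (2 : ℝ≥0∞) ^ n = ENNReal.ofReal (2 ^ n) by rw [ENNReal.ofReal_pow two_pos.le]; simp,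
    ← ENNReal.ofReal_mul (by positivity), ← ENNReal.ofReal_mul (by positivity),
    ENNReal.ofReal_le_ofReal_iff (by positivity)] at hm
  have h1 : ∫ x in B, (f x - m) ^ 2 * exp (-V x) ≤ ∫ x in B, exp C * (f x - m) ^ 2 := by
    refine setIntegral_mono_on (hi _ (by fun_prop)) (hi _ (by fun_prop)) hBm fun x hx => ?_
    rw [mul_comm (exp C)]
    gcongr
    exact (neg_le_abs _).trans (hC x hx)
  have h2 : ∫ x in B, ‖fderiv ℝ f x‖ ^ 2 ≤
      ∫ x in B, exp C * (‖fderiv ℝ f x‖ ^ 2 * exp (-V x)) := by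
    refine setIntegral_mono_on (hi _ (by fun_prop)) (hi _ (by fun_prop)) hBm fun x hx => ?_
    have a1 : 1 ≤ exp C * exp (-V x) := by
      rw [← Real.exp_add]
      exact Real.one_le_exp (by linarith [(le_abs_self _).trans (hC x hx)])
    calc _ ≤ ‖fderiv ℝ f x‖ ^ 2 * (exp C * exp (-V x)) :=
          le_mul_of_one_le_right (sq_nonneg _) a1
      _ = _ := by ring
  rw [integral_const_mul] at h1 h2
  calc _ ≤ _ := h1
    _ ≤ exp C * (P * ∫ x in B, ‖fderiv ℝ f x‖ ^ 2) := by gcongr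
    _ ≤ exp C * (P * (exp C * ∫ x in B, ‖fderiv ℝ f x‖ ^ 2 * exp (-V x))) := by gcongr
    _ = _ := by ring

lemma exists_cutoff {w : En n → ℝ} (hw : Integrable w) (hw0 : ∀ x, 0 ≤ w x) (x₀ : En n)
    {S : Set (En n)} (hS : Bornology.IsBounded S) {ε : ℝ} (hε : 0 < ε) :
    ∃ (χ : En n → ℝ) (ρ : ℝ), ContDiff ℝ 1 χ ∧ HasCompactSupport χ ∧ (∀ x, 0 ≤ χ x) ∧
      (∀ x, χ x ≤ 1) ∧ (∀ x ∈ Metric.closedBall x₀ ρ, χ x = 1) ∧ S ⊆ Metric.closedBall x₀ ρ ∧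
      ∫ x, ‖fderiv ℝ χ x‖ ^ 2 * w x ≤ ε ∧ ∫ x in (Metric.closedBall x₀ ρ)ᶜ, w x ≤ ε := by
  let φ : ContDiffBump (0 : En n) := ⟨1, 2, one_pos, one_lt_two⟩
  have hφ1 : ContDiff ℝ 1 φ := φ.contDiff
  obtain ⟨M, hM⟩ := (φ.hasCompactSupport.fderiv (𝕜 := ℝ)).exists_bound_of_continuous
    (hφ1.continuous_fderiv one_ne_zero)
  have ht1 : Filter.Tendsto (fun ρ : ℝ => ∫ x in Metric.closedBall x₀ ρ, w x) Filter.atTop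
      (nhds (∫ x, w x)) :=
    (aecover_closedBall Filter.tendsto_id).integral_tendsto_of_countably_generated hw
  have ht2 : Filter.Tendsto (fun ρ : ℝ => (ρ⁻¹ * M) ^ 2 * ∫ x, w x) Filter.atTop (nhds 0) := by
    simpa using ((tendsto_inv_atTop_zero.mul_const M).pow 2).mul_const (∫ x, w x)
  obtain ⟨ρ₀, hρ₀⟩ := hS.subset_closedBall x₀
  obtain ⟨ρ, h1, h2, h3, hρ⟩ := ((ht1.eventually_const_lt (sub_lt_self _ hε)).and
    ((ht2.eventually_lt_const hε).and ((Filter.eventually_ge_atTop ρ₀).and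
      (Filter.eventually_gt_atTop 0)))).exists
  have hd : ∀ x, ‖fderiv ℝ (fun x => φ (ρ⁻¹ • (x - x₀))) x‖ ≤ ρ⁻¹ * M := by
    intro x
    have e1 : HasFDerivAt (fun x => ρ⁻¹ • (x - x₀)) (ρ⁻¹ • ContinuousLinearMap.id ℝ (En n)) x :=
      ((hasFDerivAt_id x).sub_const x₀).fun_const_smul ρ⁻¹
    have e2 := ((hφ1.differentiable one_ne_zero (ρ⁻¹ • (x - x₀))).hasFDerivAt).comp x e1
    rw [show (fun x => φ (ρ⁻¹ • (x - x₀))) = φ ∘ fun x => ρ⁻¹ • (x - x₀) from rfl, e2.fderiv,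
      ContinuousLinearMap.comp_smul, ContinuousLinearMap.comp_id, norm_smul, norm_inv,
      Real.norm_of_nonneg hρ.le]
    gcongr
    exact hM _
  have hχ1 : ContDiff ℝ 1 fun x => φ (ρ⁻¹ • (x - x₀)) := hφ1.comp (by fun_prop)
  refine ⟨fun x => φ (ρ⁻¹ • (x - x₀)), ρ, hχ1, ?_, fun x => φ.nonneg, fun x => φ.le_one, ?_,
    hρ₀.trans (Metric.closedBall_subset_closedBall h3), ?_, ?_⟩
  · refine HasCompactSupport.intro (isCompact_closedBall x₀ (ρ * 2)) fun x hx => ?_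
    refine φ.zero_of_le_dist ?_
    rw [Metric.mem_closedBall, not_le, dist_eq_norm] at hx
    rw [dist_zero_right, norm_smul, norm_inv, Real.norm_of_nonneg hρ.le, le_inv_mul_iff₀ hρ]
    exact hx.le
  · intro x hx
    refine φ.one_of_mem_closedBall ?_
    rw [Metric.mem_closedBall, dist_eq_norm] at hx
    rw [mem_closedBall_zero_iff, norm_smul, norm_inv, Real.norm_of_nonneg hρ.le,
      inv_mul_le_iff₀ hρ]
    simpa [φ] using hx
  · refine le_trans ?_ h2.le
    rw [← integral_const_mul]
    refine integral_mono_of_nonneg (ae_of_all _ fun x => mul_nonneg (sq_nonneg _) (hw0 x))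
      (hw.const_mul _) (ae_of_all _ fun x => ?_)
    exact mul_le_mul_of_nonneg_right (pow_le_pow_left₀ (norm_nonneg _) (hd x) 2) (hw0 x)
  · rw [setIntegral_compl Metric.isClosed_closedBall.measurableSet hw]
    linarith

/-- A Poincaré inequality for compactly supported functions, in which a cutoff plays the role of
the constant function. -/
lemma exists_integral_sub_mul_cutoff_sq_le {V W : En n → ℝ} (hV : ContDiff ℝ 2 V)
    (hW : ContDiff ℝ 2 W) (hW1 : ∀ x, 1 ≤ W x) {x₀ : En n} {b c : ℝ} (hb : 0 < b) (hc : 0 < c)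
    (hLyap : ∀ x, Lop V W x ≤ (-c * ‖x - x₀‖ ^ 2 + b) * W x) :
    ∃ R P : ℝ, 0 < P ∧ ∀ f : En n → ℝ, ContDiff ℝ 1 f → HasCompactSupport f → ∃ m : ℝ,
      ∀ χ : En n → ℝ, ContDiff ℝ 1 χ → HasCompactSupport χ →
        (∀ x ∈ Metric.closedBall x₀ R, χ x = 1) →
        (∫ x, ‖fderiv ℝ (fun x => f x - m * χ x) x‖ ^ 2 * exp (-V x) ≤
          2 * ((∫ x, ‖fderiv ℝ f x‖ ^ 2 * exp (-V x)) +
            m ^ 2 * ∫ x, ‖fderiv ℝ χ x‖ ^ 2 * exp (-V x))) ∧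
        ∫ x, (f x - m * χ x) ^ 2 * exp (-V x) ≤
          P * ((∫ x, ‖fderiv ℝ f x‖ ^ 2 * exp (-V x)) +
            m ^ 2 * ∫ x, ‖fderiv ℝ χ x‖ ^ 2 * exp (-V x)) := by
  have hVc := hV.continuous
  set R := √(2 * b / c) with hR
  have hR0 : 0 < R := by positivity
  have hR2 : c * R ^ 2 = 2 * b := by
    rw [hR, Real.sq_sqrt (by positivity)]
    field_simp
  obtain ⟨K, hK0, hK⟩ := exists_integral_ball_sq_sub_le hVc x₀ hR0
  refine ⟨R, 2 * K + 2 / b, by positivity, fun f hf hcf => ?_⟩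
  obtain ⟨m, hm⟩ := hK f hf
  refine ⟨m, fun χ hχ hcχ hχ1 => ?_⟩
  set B := Metric.closedBall x₀ R with hB
  have hBm : MeasurableSet B := Metric.isClosed_closedBall.measurableSet
  set h : En n → ℝ := fun x => f x - m * χ x with hh
  have hh1 : ContDiff ℝ 1 h := hf.sub (contDiff_const.mul hχ)
  have hch : HasCompactSupport h := hcf.sub hcχ.mul_left
  have hhc := hh1.continuous
  have int : ∀ {g : En n → ℝ}, ContDiff ℝ 1 g → HasCompactSupport g →
      Integrable fun x => ‖fderiv ℝ g x‖ ^ 2 * exp (-V x) := fun {g} hg hcg => by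
    have := hg.continuous_fderiv one_ne_zero
    exact Continuous.integrable_of_hasCompactSupport (by fun_prop) hcg.norm_fderiv_sq.mul_right
  have hD : ∫ x, ‖fderiv ℝ h x‖ ^ 2 * exp (-V x) ≤
      2 * ((∫ x, ‖fderiv ℝ f x‖ ^ 2 * exp (-V x)) +
        m ^ 2 * ∫ x, ‖fderiv ℝ χ x‖ ^ 2 * exp (-V x)) := by
    rw [← integral_const_mul, ← integral_add (int hf hcf) ((int hχ hcχ).const_mul _),
      ← integral_const_mul]
    refine integral_mono (int hh1 hch)
      (((int hf hcf).add ((int hχ hcχ).const_mul _)).const_mul _) fun x => ?_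
    have e : fderiv ℝ h x = fderiv ℝ f x - m • fderiv ℝ χ x :=
      ((hf.differentiable one_ne_zero x).hasFDerivAt.sub
        ((hχ.differentiable one_ne_zero x).hasFDerivAt.const_mul m)).fderiv
    have e2 : ‖fderiv ℝ h x‖ ≤ ‖fderiv ℝ f x‖ + |m| * ‖fderiv ℝ χ x‖ := by
      rw [e, ← Real.norm_eq_abs, ← norm_smul]
      exact norm_sub_le _ _
    have e3 : ‖fderiv ℝ h x‖ ^ 2 ≤ 2 * (‖fderiv ℝ f x‖ ^ 2 + m ^ 2 * ‖fderiv ℝ χ x‖ ^ 2) := by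
      refine (pow_le_pow_left₀ (norm_nonneg _) e2 2).trans ?_
      rw [← sq_abs m]
      nlinarith [sq_nonneg (‖fderiv ℝ f x‖ - |m| * ‖fderiv ℝ χ x‖)]
    calc _ ≤ 2 * (‖fderiv ℝ f x‖ ^ 2 + m ^ 2 * ‖fderiv ℝ χ x‖ ^ 2) * exp (-V x) := by
          gcongr
      _ = _ := by ring
  refine ⟨hD, ?_⟩
  have hL := integral_norm_sub_sq_mul_sq_le_of_lyapunov hV hW hW1 hLyap hh1 hch
  have hi1 : Integrable fun x => h x ^ 2 * exp (-V x) :=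
    Continuous.integrable_of_hasCompactSupport (by fun_prop) hch.sq.mul_right
  have hi2 : Integrable fun x => h x ^ 2 * ‖x - x₀‖ ^ 2 * exp (-V x) :=
    Continuous.integrable_of_hasCompactSupport (by fun_prop) hch.sq.mul_right.mul_right
  have hin : ∫ x in B, h x ^ 2 * exp (-V x) ≤ K * ∫ x, ‖fderiv ℝ f x‖ ^ 2 * exp (-V x) := by
    have e : ∫ x in B, h x ^ 2 * exp (-V x) = ∫ x in B, (f x - m) ^ 2 * exp (-V x) :=
      setIntegral_congr_fun hBm fun x hx => by simp [hh, hχ1 x hx]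
    rw [e]
    refine hm.trans ?_
    gcongr
    · exact ae_of_all _ fun x => by positivity
    · exact int hf hcf
    · exact Measure.restrict_le_self
  have hout : R ^ 2 * ∫ x in Bᶜ, h x ^ 2 * exp (-V x) ≤
      ∫ x, h x ^ 2 * ‖x - x₀‖ ^ 2 * exp (-V x) := by
    rw [← integral_const_mul]
    refine le_trans (setIntegral_mono_on (hi1.const_mul _).integrableOn hi2.integrableOn hBm.compl
      fun x hx => ?_) (setIntegral_le_integral hi2 (ae_of_all _ fun x => by positivity))
    rw [mem_compl_iff, hB, Metric.mem_closedBall, not_le, dist_eq_norm] at hx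
    calc R ^ 2 * (h x ^ 2 * exp (-V x)) ≤ ‖x - x₀‖ ^ 2 * (h x ^ 2 * exp (-V x)) := by gcongr
      _ = _ := by ring
  have hsum := integral_add_compl hBm hi1
  have hpos : 0 ≤ m ^ 2 * ∫ x, ‖fderiv ℝ χ x‖ ^ 2 * exp (-V x) :=
    mul_nonneg (sq_nonneg _) (integral_nonneg fun x => by positivity)
  set I := ∫ x, ‖fderiv ℝ f x‖ ^ 2 * exp (-V x)
  set J := m ^ 2 * ∫ x, ‖fderiv ℝ χ x‖ ^ 2 * exp (-V x)
  set X := ∫ x in B, h x ^ 2 * exp (-V x)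
  set Y := ∫ x in Bᶜ, h x ^ 2 * exp (-V x)
  have h1 : c * (R ^ 2 * Y) ≤ _ := (mul_le_mul_of_nonneg_left hout hc.le).trans hL
  rw [← mul_assoc, hR2, ← hsum] at h1
  have h2 : b * Y ≤ 2 * (I + J) + b * X := by nlinarith
  have h3 : Y ≤ 2 / b * (I + J) + X := by
    rw [← mul_le_mul_iff_right₀ hb]
    refine h2.trans (le_of_eq ?_)
    field_simp
  rw [← hsum]
  nlinarith [mul_nonneg hK0 hpos]

lemma sub_le_mul_log_sub {N a : ℝ} (hN : 0 ≤ N) (ha : 0 < a) :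
    N - a ≤ N * log N - N * log a := by
  rcases hN.eq_or_lt with rfl | hN
  · simpa using ha.le
  · have h := Real.log_le_sub_one_of_pos (div_pos ha hN)
    rw [Real.log_div ha.ne' hN.ne'] at h
    have h2 := mul_le_mul_of_nonneg_left h hN.le
    have h3 : N * (a / N - 1) = a - N := by field_simp
    linarith

lemma sq_mul_log_sq_le_log_one_add {y s : ℝ} (hs : 0 < s) :
    y ^ 2 * log (y ^ 2) - y ^ 2 * log s ≤ y ^ 2 * log (1 + y ^ 2 / s) := by
  rcases eq_or_ne y 0 with rfl | hy
  · simp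
  · have hy2 : 0 < y ^ 2 := by positivity
    rw [← mul_sub, ← Real.log_div hy2.ne' hs.ne']
    have : 0 < y ^ 2 / s := by positivity
    gcongr
    linarith

lemma one_add_sq_mul_log_sub_le (k : ℝ) :
    (1 + k) ^ 2 * log ((1 + k) ^ 2) - (1 + k) ^ 2 + 1 ≤
      9 * k ^ 2 + 4 * k ^ 2 * log (1 + k ^ 2) := by
  have hl : 0 ≤ log (1 + k ^ 2) := Real.log_nonneg (by nlinarith)
  rcases eq_or_ne (1 + k) 0 with h0 | h0
  · have : k = -1 := by linarith
    subst this
    norm_num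
    norm_num at hl
    linarith
  set t := (1 + k) ^ 2 with ht
  have ht0 : 0 < t := by positivity
  rcases le_or_gt |k| 1 with hk | hk
  · have h1 : t * log t ≤ t * (t - 1) :=
      mul_le_mul_of_nonneg_left (Real.log_le_sub_one_of_pos ht0) ht0.le
    have h2 : (t - 1) ^ 2 ≤ 9 * k ^ 2 := by
      have e : (t - 1) ^ 2 = k ^ 2 * (2 + k) ^ 2 := by rw [ht]; ring
      have : (2 + k) ^ 2 ≤ 9 := by
        have := abs_le.1 hk
        nlinarith
      rw [e]
      nlinarith [sq_nonneg k]
    have h3 : 0 ≤ 4 * k ^ 2 * log (1 + k ^ 2) := by positivity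
    nlinarith
  · have hk2 : 1 ≤ k ^ 2 := by
      rw [← sq_abs]
      nlinarith
    have h1 : t ≤ 4 * k ^ 2 := by
      rw [ht]
      nlinarith [neg_abs_le k, le_abs_self k, sq_abs k]
    have h4 : log t ≤ log 4 + log (1 + k ^ 2) := by
      rw [← Real.log_mul (by norm_num) (by positivity)]
      exact Real.log_le_log ht0 (by linarith)
    have h5 : log 4 ≤ 2 := by
      rw [show (4 : ℝ) = 2 ^ 2 by norm_num, Real.log_pow]
      push_cast
      linarith [Real.log_two_lt_d9]
    have h6 : t * log t ≤ t * (2 + log (1 + k ^ 2)) := by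
      gcongr
      linarith
    have h7 : t * log (1 + k ^ 2) ≤ 4 * k ^ 2 * log (1 + k ^ 2) := by gcongr
    nlinarith

lemma add_sq_mul_log_sub_le {m : ℝ} (hm : m ≠ 0) (h : ℝ) :
    (m + h) ^ 2 * log ((m + h) ^ 2) - (m + h) ^ 2 * log (m ^ 2) - (m + h) ^ 2 + m ^ 2 ≤
      9 * h ^ 2 + 4 * (h ^ 2 * log (1 + h ^ 2 / m ^ 2)) := by
  have hm2 : 0 < m ^ 2 := by positivity
  have e1 : (m + h) ^ 2 = m ^ 2 * (1 + h / m) ^ 2 := by field_simp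
  have key := mul_le_mul_of_nonneg_left (one_add_sq_mul_log_sub_le (h / m)) hm2.le
  have e2 : m ^ 2 * (9 * (h / m) ^ 2 + 4 * (h / m) ^ 2 * log (1 + (h / m) ^ 2)) =
      9 * h ^ 2 + 4 * (h ^ 2 * log (1 + h ^ 2 / m ^ 2)) := by
    rw [div_pow]
    field_simp
  rw [e2] at key
  refine le_trans (le_of_eq ?_) key
  rcases eq_or_ne (1 + h / m) 0 with h0 | h0
  · rw [e1, h0]
    simp
  · rw [e1, Real.log_mul hm2.ne' (by positivity)]
    ring

lemma integrable_sq_mul_log_sq_mul {f w : En n → ℝ} (hf : Continuous f)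
    (hcf : HasCompactSupport f) (hw : Continuous w) :
    Integrable fun x => f x ^ 2 * log (f x ^ 2) * w x :=
  Continuous.integrable_of_hasCompactSupport
    ((Real.continuous_mul_log.comp (hf.pow 2)).mul hw) hcf.sq.mul_right.mul_right

/-- The logarithmic Sobolev inequality with respect to a density of total mass one. -/
lemma exists_entropy_le_of_lyapunov (hn : 0 < n) {V W : En n → ℝ} (hV : ContDiff ℝ 2 V)
    (hVint : Integrable fun x => exp (-V x)) (hV1 : ∫ x, exp (-V x) = 1)
    (hW : ContDiff ℝ 2 W) (hW1 : ∀ x, 1 ≤ W x) {x₀ : En n} {b c : ℝ} (hb : 0 < b) (hc : 0 < c)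
    (hLyap : ∀ x, Lop V W x ≤ (-c * ‖x - x₀‖ ^ 2 + b) * W x) {δ : ℝ}
    (hHess : ∀ x v : En n, δ * ‖v‖ ^ 2 ≤ iteratedFDeriv ℝ 2 V x ![v, v]) :
    ∃ C : ℝ, 0 < C ∧ ∀ f : En n → ℝ, ContDiff ℝ 1 f → HasCompactSupport f →
      (∫ x, f x ^ 2 * log (f x ^ 2) * exp (-V x)) -
          (∫ x, f x ^ 2 * exp (-V x)) * log (∫ x, f x ^ 2 * exp (-V x)) ≤
        C * ∫ x, ‖fderiv ℝ f x‖ ^ 2 * exp (-V x) := by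
  have hVc := hV.continuous
  obtain ⟨A, hA0, hA⟩ := exists_integral_sq_mul_log_le hn hV hW hW1 hb hc hLyap hHess
  obtain ⟨R, P, hP0, hP⟩ := exists_integral_sub_mul_cutoff_sq_le hV hW hW1 hb hc hLyap
  set Q : ℝ := 2 * P * (1 + 2 * P) + 4 * P with hQ
  have hQ0 : 0 < Q := by positivity
  set C₁ : ℝ := (A + 1) * Q + A with hC₁
  set C₂ : ℝ := 9 * P + 4 * A * P + 8 * A with hC₂
  have hC₁0 : 0 ≤ C₁ := by positivity
  have hC₂0 : 0 < C₂ := by positivity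
  refine ⟨C₁ + C₂, by positivity, fun f hf hcf => ?_⟩
  obtain ⟨m, hm⟩ := hP f hf hcf
  have hfc := hf.continuous
  set N := ∫ x, f x ^ 2 * exp (-V x) with hN
  set I := ∫ x, ‖fderiv ℝ f x‖ ^ 2 * exp (-V x) with hI
  have hN0 : 0 ≤ N := integral_nonneg fun x => by positivity
  have hI0 : 0 ≤ I := integral_nonneg fun x => by positivity
  have hif : Integrable fun x => f x ^ 2 * exp (-V x) :=
    Continuous.integrable_of_hasCompactSupport (by fun_prop) hcf.sq.mul_right
  have hifl : Integrable fun x => f x ^ 2 * log (f x ^ 2) * exp (-V x) :=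
    integrable_sq_mul_log_sq_mul hfc hcf (by fun_prop)
  have hilog : ∀ {g : En n → ℝ} {s : ℝ}, 0 < s → Continuous g → HasCompactSupport g →
      Integrable fun x => g x ^ 2 * log (1 + g x ^ 2 / s) * exp (-V x) := by
    intro g s hs hg hcg
    refine Continuous.integrable_of_hasCompactSupport ?_ hcg.sq.mul_right.mul_right
    refine ((hg.pow 2).mul (Continuous.log (by fun_prop) fun x => ?_)).mul (by fun_prop)
    positivity
  have hcut : ∀ ε, 0 < ε → ∃ (χ : En n → ℝ) (B : Set (En n)), ContDiff ℝ 1 χ ∧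
      HasCompactSupport χ ∧ MeasurableSet B ∧ (∀ x, χ x ^ 2 ≤ 1) ∧ (∀ x ∈ B, χ x = 1) ∧
      (∀ x ∉ B, f x = 0) ∧ ∫ x in Bᶜ, exp (-V x) ≤ ε ∧
      (∫ x, ‖fderiv ℝ (fun x => f x - m * χ x) x‖ ^ 2 * exp (-V x) ≤ 2 * (I + m ^ 2 * ε)) ∧
      ∫ x, (f x - m * χ x) ^ 2 * exp (-V x) ≤ P * (I + m ^ 2 * ε) := by
    intro ε hε
    obtain ⟨χ, ρ, h1, h2, h3, h4, h5, h6, h7, h8⟩ := exists_cutoff hVint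
      (fun x => (exp_pos (-V x)).le) x₀
      (hcf.isCompact.isBounded.union (Metric.isBounded_closedBall (x := x₀) (r := R))) hε
    obtain ⟨hm1, hm2⟩ := hm χ h1 h2 fun x hx => h5 x (h6 (Or.inr hx))
    refine ⟨χ, Metric.closedBall x₀ ρ, h1, h2, Metric.isClosed_closedBall.measurableSet,
      fun x => pow_le_one₀ (h3 x) (h4 x), h5,
      fun x hx => image_eq_zero_of_notMem_tsupport fun hx2 => hx (h6 (Or.inl hx2)), h8,
      hm1.trans ?_, hm2.trans ?_⟩ <;> gcongr
  have hvar : ∀ a, 0 < a → (∫ x, f x ^ 2 * log (f x ^ 2) * exp (-V x)) - N * log N ≤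
      (∫ x, f x ^ 2 * log (f x ^ 2) * exp (-V x)) - log a * N - N + a := by
    intro a ha
    linarith [sub_le_mul_log_sub hN0 ha]
  rcases le_or_gt (m ^ 2) (2 * P * I) with hmI | hmI
  · suffices h : (∫ x, f x ^ 2 * log (f x ^ 2) * exp (-V x)) - N * log N ≤ C₁ * I from
      h.trans (by gcongr; linarith)
    obtain ⟨χ, B, h1, h2, -, h4, -, -, -, -, h9⟩ := hcut 1 one_pos
    have hχc := h1.continuous
    have hih : Integrable fun x => (f x - m * χ x) ^ 2 * exp (-V x) :=
      Continuous.integrable_of_hasCompactSupport (by fun_prop)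
        (hcf.sub h2.mul_left : HasCompactSupport fun x => f x - m * χ x).sq.mul_right
    have hNQ : N ≤ Q * I := by
      have hle : N ≤ ∫ x, 2 * ((f x - m * χ x) ^ 2 * exp (-V x)) + 2 * m ^ 2 * exp (-V x) := by
        refine integral_mono hif ((hih.const_mul _).add (hVint.const_mul _)) fun x => ?_
        have e : f x ^ 2 ≤ 2 * (f x - m * χ x) ^ 2 + 2 * m ^ 2 := by
          nlinarith [sq_nonneg (f x - m * χ x - m * χ x), h4 x, sq_nonneg m,
            mul_le_mul_of_nonneg_left (h4 x) (sq_nonneg m)]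
        calc _ ≤ (2 * (f x - m * χ x) ^ 2 + 2 * m ^ 2) * exp (-V x) := by gcongr
          _ = _ := by ring
      rw [integral_add (hih.const_mul _) (hVint.const_mul _), integral_const_mul,
        integral_const_mul, hV1] at hle
      have := mul_le_mul_of_nonneg_left hmI hP0.le
      rw [hQ]
      linarith
    refine le_of_forall_pos_le_add fun η hη => ?_
    set s := Q * I + η / (A + 1) with hs
    have hη1 : 0 < η / (A + 1) := by positivity
    have hs0 : 0 < s := by positivity
    have hlog : (∫ x, f x ^ 2 * log (f x ^ 2) * exp (-V x)) - log s * N ≤ A * (s + I) := by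
      refine le_trans ?_ (hA f hf hcf s hs0 (by linarith))
      rw [hN, ← integral_const_mul, ← integral_sub hifl (hif.const_mul _)]
      refine integral_mono (hifl.sub (hif.const_mul _)) (hilog hs0 hfc hcf) fun x => ?_
      calc _ = (f x ^ 2 * log (f x ^ 2) - f x ^ 2 * log s) * exp (-V x) := by ring
        _ ≤ _ := by
          gcongr
          exact sq_mul_log_sq_le_log_one_add hs0
    have e : (A + 1) * s = (A + 1) * Q * I + η := by
      rw [hs]
      field_simp
    linarith [hvar s hs0]
  · suffices h : (∫ x, f x ^ 2 * log (f x ^ 2) * exp (-V x)) - N * log N ≤ C₂ * I from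
      h.trans (by gcongr; linarith)
    have hm2 : 0 < m ^ 2 := lt_of_le_of_lt (by positivity) hmI
    have hm0 : m ≠ 0 := by
      rintro rfl
      simp at hm2
    refine le_of_forall_pos_le_add fun η hη => ?_
    set ε := min (1 / (2 * P)) (η / ((C₂ + 1) * m ^ 2)) with hε
    have hε0 : 0 < ε := by positivity
    have hε1 : P * (m ^ 2 * ε) ≤ m ^ 2 / 2 := by
      calc _ ≤ P * (m ^ 2 * (1 / (2 * P))) := by
            gcongr
            exact min_le_left _ _
        _ = _ := by field_simp
    have hε2 : (C₂ + 1) * (m ^ 2 * ε) ≤ η := by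
      calc _ ≤ (C₂ + 1) * (m ^ 2 * (η / ((C₂ + 1) * m ^ 2))) := by
            gcongr
            exact min_le_right _ _
        _ = _ := by field_simp
    obtain ⟨χ, B, h1, h2, hB, -, h5, h6, h7, h8, h9⟩ := hcut ε hε0
    have hχc := h1.continuous
    set h : En n → ℝ := fun x => f x - m * χ x with hh
    have hh1 : ContDiff ℝ 1 h := hf.sub (contDiff_const.mul h1)
    have hch : HasCompactSupport h := hcf.sub h2.mul_left
    have hhc := hh1.continuous
    have hih : Integrable fun x => h x ^ 2 * exp (-V x) :=
      Continuous.integrable_of_hasCompactSupport (by fun_prop) hch.sq.mul_right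
    set s := P * (I + m ^ 2 * ε) with hs
    have hs0 : 0 < s := by positivity
    have hsm : s ≤ m ^ 2 := by
      rw [hs]
      linarith
    have hdef := hA h hh1 hch s hs0 h9
    have hib : Integrable (Bᶜ.indicator fun x => exp (-V x)) := hVint.indicator hB.compl
    have hmain : (∫ x, f x ^ 2 * log (f x ^ 2) * exp (-V x)) - log (m ^ 2) * N - N + m ^ 2 ≤
        9 * (∫ x, h x ^ 2 * exp (-V x)) +
          4 * (∫ x, h x ^ 2 * log (1 + h x ^ 2 / s) * exp (-V x)) +
          m ^ 2 * ∫ x in Bᶜ, exp (-V x) := by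
      have i1 : Integrable fun x => f x ^ 2 * log (f x ^ 2) * exp (-V x) -
          log (m ^ 2) * (f x ^ 2 * exp (-V x)) := hifl.sub (hif.const_mul _)
      have i2 : Integrable fun x => f x ^ 2 * log (f x ^ 2) * exp (-V x) -
          log (m ^ 2) * (f x ^ 2 * exp (-V x)) - f x ^ 2 * exp (-V x) := i1.sub hif
      have i3 := (hih.const_mul 9).fun_add ((hilog hs0 hhc hch).const_mul 4)
      have hl : ∫ x, (f x ^ 2 * log (f x ^ 2) * exp (-V x) -
            log (m ^ 2) * (f x ^ 2 * exp (-V x)) - f x ^ 2 * exp (-V x) + m ^ 2 * exp (-V x)) =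
          (∫ x, f x ^ 2 * log (f x ^ 2) * exp (-V x)) - log (m ^ 2) * N - N + m ^ 2 := by
        rw [integral_add i2 (hVint.const_mul _), integral_sub i1 hif,
          integral_sub hifl (hif.const_mul _), integral_const_mul, integral_const_mul, hV1, mul_one]
      rw [← hl, ← integral_indicator hB.compl, ← integral_const_mul, ← integral_const_mul,
        ← integral_add (hih.const_mul _) ((hilog hs0 hhc hch).const_mul _), ← integral_const_mul,
        ← integral_add i3 (hib.const_mul _)]
      refine integral_mono (i2.add (hVint.const_mul _)) (i3.add (hib.const_mul _)) fun x => ?_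
      by_cases hx : x ∈ B
      · have hx2 : x ∉ Bᶜ := fun h => h hx
        have e : f x = m + h x := by
          simp only [hh, h5 x hx]
          ring
        have hl : h x ^ 2 * log (1 + h x ^ 2 / m ^ 2) ≤ h x ^ 2 * log (1 + h x ^ 2 / s) := by
          gcongr
        have key := add_sq_mul_log_sub_le hm0 (h x)
        rw [← e] at key
        have key' : f x ^ 2 * log (f x ^ 2) - f x ^ 2 * log (m ^ 2) - f x ^ 2 + m ^ 2 ≤
            9 * h x ^ 2 + 4 * (h x ^ 2 * log (1 + h x ^ 2 / s)) := by linarith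
        have := mul_le_mul_of_nonneg_right key' (exp_pos (-V x)).le
        simp only [indicator_of_notMem hx2]
        linarith
      · have hx2 : x ∈ Bᶜ := hx
        have hl : 0 ≤ h x ^ 2 * log (1 + h x ^ 2 / s) :=
          mul_nonneg (sq_nonneg _) (Real.log_nonneg (by
            have : 0 ≤ h x ^ 2 / s := by positivity
            linarith))
        have := mul_nonneg hl (exp_pos (-V x)).le
        have : 0 ≤ h x ^ 2 * exp (-V x) := by positivity
        simp only [indicator_of_mem hx2, h6 x hx]
        norm_num
        linarith
    have h7' := mul_le_mul_of_nonneg_left h7 hm2.le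
    have h10 := mul_le_mul_of_nonneg_left h8 hA0
    have e : 9 * s + 4 * (A * (s + 2 * (I + m ^ 2 * ε))) = C₂ * (I + m ^ 2 * ε) := by
      rw [hs, hC₂]
      ring
    linarith [hvar (m ^ 2) hm2]

lemma integral_boltz {V : En n → ℝ} (hV : Continuous V) (hVint : Integrable fun x => exp (-V x))
    (g : En n → ℝ) :
    ∫ x, g x ∂(boltz V) = ∫ x, g x * exp (-(V x + log (∫ y, exp (-V y)))) := by
  have hZ : 0 < ∫ y, exp (-V y) := integral_exp_pos hVint
  rw [boltz, integral_withDensity_eq_integral_toReal_smul]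
  · refine integral_congr_ae (ae_of_all _ fun x => ?_)
    simp only [smul_eq_mul]
    rw [ENNReal.toReal_ofReal (by positivity), neg_add, Real.exp_add, Real.exp_neg (log _),
      Real.exp_log hZ]
    ring
  · exact (by fun_prop : Continuous fun x => exp (-V x) / ∫ y, exp (-V y)).measurable.ennreal_ofReal
  · exact ae_of_all _ fun x => ENNReal.ofReal_lt_top

lemma Lop_add_const (V W : En n → ℝ) (a : ℝ) : Lop (fun x => V x + a) W = Lop V W := by
  funext x
  simp [Lop, gradient, fderiv_add_const]

lemma iteratedFDeriv_two_add_const (V : En n → ℝ) (a : ℝ) (x : En n) (m : Fin 2 → En n) :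
    iteratedFDeriv ℝ 2 (fun x => V x + a) x m = iteratedFDeriv ℝ 2 V x m := by
  rw [iteratedFDeriv_two_apply, iteratedFDeriv_two_apply]
  have : fderiv ℝ (fun x => V x + a) = fderiv ℝ V := by
    funext y
    exact fderiv_add_const a
  rw [this]

end

/-- the Lyapunov condition `LW ≤ (-c d²(x,x₀) + b) W` together with the
curvature lower bound `Hess V ≥ δ Id` (`δ` possibly negative) implies a logarithmic Sobolev
inequality. -/
theorem stmt12 {n : ℕ} (hn : 0 < n) (V : En n → ℝ) (hV : ContDiff ℝ 2 V)
    (hVint : Integrable (fun x => Real.exp (-V x)))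
    (W : En n → ℝ) (hW : ContDiff ℝ 2 W) (hW1 : ∀ x, 1 ≤ W x)
    (x₀ : En n) (b c : ℝ) (hb : 0 < b) (hc : 0 < c)
    (hLyap : ∀ x, Lop V W x ≤ (-c * ‖x - x₀‖ ^ 2 + b) * W x)
    (δ : ℝ)
    (hHess : ∀ x v : En n, δ * ‖v‖ ^ 2 ≤ iteratedFDeriv ℝ 2 V x ![v, v]) :
    ∃ C : ℝ, 0 < C ∧ ∀ f : En n → ℝ, ContDiff ℝ (⊤ : ℕ∞) f → HasCompactSupport f →
      ∫ x, (f x) ^ 2 * Real.log ((f x) ^ 2) ∂(boltz V)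
          - (∫ x, (f x) ^ 2 ∂(boltz V)) * Real.log (∫ x, (f x) ^ 2 ∂(boltz V))
        ≤ C * ∫ x, ‖gradient f x‖ ^ 2 ∂(boltz V) := by
  set a := Real.log (∫ y, Real.exp (-V y)) with ha
  have hZ : 0 < ∫ y, Real.exp (-V y) := integral_exp_pos hVint
  have he : ∀ x, Real.exp (-(V x + a)) = Real.exp (-V x) * (∫ y, Real.exp (-V y))⁻¹ := fun x => by
    rw [neg_add, Real.exp_add, Real.exp_neg a, ha, Real.exp_log hZ]
  obtain ⟨C, hC, h⟩ := exists_entropy_le_of_lyapunov hn (V := fun x => V x + a)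
    (hV.add contDiff_const) (by simp only [he]; exact hVint.mul_const _)
    (by simp only [he]; rw [integral_mul_const, mul_inv_cancel₀ hZ.ne']) hW hW1 hb hc
    (fun x => by rw [Lop_add_const]; exact hLyap x) (δ := δ)
    (fun x v => by rw [iteratedFDeriv_two_add_const]; exact hHess x v)
  refine ⟨C, hC, fun f hf hcf => ?_⟩
  simp only [integral_boltz hV.continuous hVint, norm_gradient_eq]
  exact h f (hf.of_le (by exact_mod_cast le_top)) hcf
end
end

section
/- Cauchy-type measures satisfy a φ-Lyapunov condition: let U : ℝⁿ → ℝ be a C² convex function with U(x) ≥ c₀ > 0 for all x, let β > 0, set V = (n + β) log U, and assume ∫ e^{-V(x)} dx < ∞. Let k > 2 be such that there exists ε > 0 with k + nε − 2 − β(1 − ε) < 0. Then there exist constants c > 0, b > 0, R > 0 and a C² function W : ℝⁿ → ℝ with W ≥ 1 such that LW(x) ≤ −c·W(x)^{(k−2)/k} + b·1_{|x| ≤ R}(x) for all x; moreover W can be chosen so that W(x) = |x|^k for all |x| large enough. -/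
open MeasureTheory Real Set
open scoped ENNReal RealInnerProductSpace

noncomputable section

open Filter Topology in
/-- A convex set of finite Haar measure that contains a ball is bounded. -/
theorem Convex.isBounded_of_measure_ne_top {E : Type*} [NormedAddCommGroup E] [NormedSpace ℝ E]
    [ProperSpace E] [MeasurableSpace E] [BorelSpace E] (μ : Measure E) [μ.IsAddHaarMeasure]
    {s : Set E} (hs : Convex ℝ s) (hμ : μ s ≠ ∞) {z : E} {r : ℝ}
    (hr : 0 < r) (hz : Metric.ball z r ⊆ s) : Bornology.IsBounded s := by
  have : IsFiniteMeasure (μ.restrict s) := isFiniteMeasure_restrict.2 hμ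
  have htight := tendsto_measure_norm_gt_of_isTightMeasureSet
    (isTightMeasureSet_singleton (μ := μ.restrict s))
  simp only [mem_singleton_iff, iSup_iSup_eq_left] at htight
  obtain ⟨ρ, hρ⟩ := (htight.eventually_lt_const
    (Metric.measure_ball_pos μ (0 : E) (half_pos hr))).exists
  refine isBounded_iff_forall_norm_le.2 ⟨2 * ρ + ‖z‖ + r, fun x hx => ?_⟩
  by_contra! hxn
  have hnorm : ‖x‖ - ‖z‖ ≤ 2 * ‖midpoint ℝ z x‖ := by
    have h : x = (2 : ℝ) • midpoint ℝ z x - z := by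
      rw [midpoint_eq_smul_add, smul_smul]; simp
    have h' := norm_sub_le ((2 : ℝ) • midpoint ℝ z x) z
    rw [← h, norm_smul, Real.norm_ofNat] at h'
    linarith
  have hsub : Metric.ball (midpoint ℝ z x) (r / 2) ⊆ {y | ρ < ‖y‖} ∩ s := by
    intro y hy
    rw [mem_ball_iff_norm] at hy
    constructor
    · have h := norm_sub_norm_le (midpoint ℝ z x) y
      rw [norm_sub_rev] at h
      simp only [mem_ofPred_eq]
      linarith
    · have hmem : (2 : ℝ) • y - x ∈ s := by
        apply hz
        have h : (2 : ℝ) • y - x - z = (2 : ℝ) • (y - midpoint ℝ z x) := by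
          rw [midpoint_eq_smul_add, smul_sub, smul_smul]; simp; abel
        rw [mem_ball_iff_norm, h, norm_smul, Real.norm_ofNat]
        linarith
      have h := hs hmem hx (a := 1 / 2) (b := 1 / 2) (by norm_num) (by norm_num) (by norm_num)
      rw [smul_sub, smul_smul] at h
      simpa using h
  have hle := measure_mono (μ := μ) hsub
  rw [← Measure.restrict_apply (measurableSet_lt measurable_const measurable_norm),
    Measure.addHaar_ball_center] at hle
  exact absurd hρ (not_lt.2 hle)

/-- A differentiable convex function lies above its tangents along rays from the origin. -/
theorem ConvexOn.sub_le_fderiv_apply_self {E : Type*} [NormedAddCommGroup E] [NormedSpace ℝ E]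
    {f : E → ℝ} (hf : ConvexOn ℝ univ f) {x : E} (hd : DifferentiableAt ℝ f x) :
    f x - f 0 ≤ fderiv ℝ f x x := by
  have hconv : ConvexOn ℝ univ (fun t : ℝ => f (t • x)) :=
    hf.comp_linearMap (LinearMap.toSpanSingleton ℝ E x)
  have hderiv : HasDerivAt (fun t : ℝ => f (t • x)) (fderiv ℝ f x x) 1 := by
    have h1 : HasDerivAt (fun t : ℝ => t • x) x 1 := by
      simpa using (hasDerivAt_id (1 : ℝ)).smul_const x
    have h2 : HasFDerivAt f (fderiv ℝ f x) ((1 : ℝ) • x) := by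
      rw [one_smul]; exact hd.hasFDerivAt
    exact h2.comp_hasDerivAt 1 h1
  simpa [slope_def_field] using
    hconv.slope_le_of_hasDerivAt (mem_univ 0) (mem_univ 1) one_pos hderiv

theorem continuous_Lop {n : ℕ} {V g : En n → ℝ} (hV : ContDiff ℝ 1 V) (hg : ContDiff ℝ 2 g) :
    Continuous (Lop V g) := by
  have hgrad : ∀ {f : En n → ℝ}, ContDiff ℝ 1 f → Continuous (gradient f) := fun hf =>
    (InnerProductSpace.toDual ℝ (En n)).symm.continuous.comp (hf.continuous_fderiv one_ne_zero)
  refine Continuous.sub (continuous_finsetSum _ fun i _ => ?_)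
    ((hgrad hV).inner (hgrad (hg.of_le one_le_two)))
  have h : ContDiff ℝ 1 fun y => fderiv ℝ g y (EuclideanSpace.single i 1) :=
    (hg.fderiv_right (m := 1) (by norm_num)).clm_apply contDiff_const
  exact (h.continuous_fderiv one_ne_zero).clm_apply continuous_const

theorem Lop_congr {n : ℕ} {V g₁ g₂ : En n → ℝ} {x : En n} (h : g₁ =ᶠ[nhds x] g₂) :
    Lop V g₁ x = Lop V g₂ x := by
  have hfd := h.fderiv (𝕜 := ℝ)
  unfold Lop lapl gradient
  rw [hfd.eq_of_nhds]
  congr 1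
  refine Finset.sum_congr rfl fun i _ => ?_
  have hi : (fun y => fderiv ℝ g₁ y (EuclideanSpace.single i 1)) =ᶠ[nhds x]
      fun y => fderiv ℝ g₂ y (EuclideanSpace.single i 1) :=
    hfd.mono fun y hy => by simp only [hy]
  rw [hi.fderiv_eq]

theorem lapl_norm_rpow {n : ℕ} {k : ℝ} (hk : 1 < k) {x : En n} (hx : x ≠ 0) :
    lapl (fun y => ‖y‖ ^ k) x = k * (n + k - 2) * ‖x‖ ^ (k - 2) := by
  have hpos : 0 < ‖x‖ := norm_pos_iff.2 hx
  have hpartial : ∀ i : Fin n,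
      (fun y : En n => fderiv ℝ (fun y => ‖y‖ ^ k) y (EuclideanSpace.single i 1)) =
        fun y => k * (‖y‖ ^ 2) ^ ((k - 2) / 2) * y i := by
    intro i
    ext y
    rw [(hasFDerivAt_norm_rpow y hk).fderiv, ← Real.rpow_natCast, ← Real.rpow_mul (norm_nonneg y)]
    simp [EuclideanSpace.inner_single_right, mul_div_cancel₀]
  have hsecond : ∀ i : Fin n,
      fderiv ℝ (fun y : En n => fderiv ℝ (fun y => ‖y‖ ^ k) y (EuclideanSpace.single i 1)) x
        (EuclideanSpace.single i 1) =
        k * (k - 2) * ‖x‖ ^ (k - 4) * x i ^ 2 + k * ‖x‖ ^ (k - 2) := by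
    intro i
    have h1 : HasFDerivAt (fun y : En n => ‖y‖ ^ 2) (2 • innerSL ℝ x) x :=
      (hasStrictFDerivAt_norm_sq x).hasFDerivAt
    have h2 := (h1.rpow_const (p := (k - 2) / 2) (Or.inl (by positivity))).const_mul k
    have h3 : HasFDerivAt (fun y : En n => y i) (EuclideanSpace.proj i : En n →L[ℝ] ℝ) x :=
      (EuclideanSpace.proj i : En n →L[ℝ] ℝ).hasFDerivAt
    have h4 : HasFDerivAt (fun y : En n => k * (‖y‖ ^ 2) ^ ((k - 2) / 2) * y i) _ x := h2.mul h3
    rw [hpartial i, h4.fderiv, ← Real.rpow_natCast, ← Real.rpow_mul hpos.le,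
      ← Real.rpow_mul hpos.le]
    have e1 : ((2 : ℕ) : ℝ) * ((k - 2) / 2) = k - 2 := by push_cast; ring
    have e2 : ((2 : ℕ) : ℝ) * ((k - 2) / 2 - 1) = k - 4 := by push_cast; ring
    rw [e1, e2]
    simp [EuclideanSpace.inner_single_right]
    ring
  have hpow : ‖x‖ ^ (k - 4) * ‖x‖ ^ 2 = ‖x‖ ^ (k - 2) := by
    rw [← Real.rpow_natCast, ← Real.rpow_add hpos]
    congr 1; push_cast; ring
  unfold lapl
  rw [Finset.sum_congr rfl fun i _ => hsecond i, Finset.sum_add_distrib, ← Finset.mul_sum,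
    ← EuclideanSpace.real_norm_sq_eq, mul_assoc, hpow]
  simp
  ring

theorem Lop_norm_rpow {n : ℕ} (V : En n → ℝ) {k : ℝ} (hk : 1 < k) {x : En n} (hx : x ≠ 0) :
    Lop V (fun y => ‖y‖ ^ k) x = k * ‖x‖ ^ (k - 2) * (n + k - 2 - fderiv ℝ V x x) := by
  have hgrad : gradient (fun y : En n => ‖y‖ ^ k) x = (k * ‖x‖ ^ (k - 2)) • x := by
    unfold gradient
    rw [(hasFDerivAt_norm_rpow x hk).fderiv, map_smulₛₗ]
    exact congrArg _ ((InnerProductSpace.toDual ℝ (En n)).symm_apply_apply x)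
  rw [Lop, lapl_norm_rpow hk hx, hgrad, inner_gradient_left, map_smul, smul_eq_mul]
  ring

/-- There is a smooth function, at least `1`, which agrees with `‖x‖ ^ k` away from a ball. -/
theorem exists_contDiff_eq_norm_rpow (n : ℕ) {k : ℝ} (hk : 0 ≤ k) :
    ∃ W : En n → ℝ, ContDiff ℝ 2 W ∧ (∀ x, 1 ≤ W x) ∧ ∀ x, 2 ≤ ‖x‖ → W x = ‖x‖ ^ k := by
  have hpow : ∀ x : En n, (‖x‖ ^ 2) ^ (k / 2) = ‖x‖ ^ k := fun x => by
    rw [← Real.rpow_natCast, ← Real.rpow_mul (norm_nonneg x)]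
    congr 1; push_cast; ring
  refine ⟨fun x => 1 + smoothTransition (‖x‖ ^ 2 - 1) * ((‖x‖ ^ 2) ^ (k / 2) - 1), ?_, ?_, ?_⟩
  · rw [contDiff_iff_contDiffAt]
    intro x
    rcases eq_or_ne x 0 with rfl | hx
    · have h : (fun x : En n => 1 + smoothTransition (‖x‖ ^ 2 - 1) * ((‖x‖ ^ 2) ^ (k / 2) - 1))
          =ᶠ[nhds 0] fun _ => 1 := by
        filter_upwards [Metric.ball_mem_nhds (0 : En n) one_pos] with y hy
        rw [mem_ball_zero_iff] at hy
        rw [smoothTransition.zero_of_nonpos (by nlinarith [norm_nonneg y]), zero_mul, add_zero]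
      exact contDiffAt_const.congr_of_eventuallyEq h
    · have hsq : ContDiffAt ℝ 2 (fun y : En n => ‖y‖ ^ 2) x := (contDiff_norm_sq ℝ).contDiffAt
      have hst : ContDiffAt ℝ 2 (fun y : En n => smoothTransition (‖y‖ ^ 2 - 1)) x :=
        (smoothTransition.contDiff (n := 2)).contDiffAt.comp x (hsq.sub contDiffAt_const)
      exact contDiffAt_const.add (hst.mul
        ((hsq.rpow_const_of_ne (by simpa using hx)).sub contDiffAt_const))
  · intro x
    beta_reduce
    rcases le_total ‖x‖ 1 with h | h
    · rw [smoothTransition.zero_of_nonpos (by nlinarith [norm_nonneg x])]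
      simp
    · have h1 : 1 ≤ (‖x‖ ^ 2) ^ (k / 2) := by
        rw [hpow]; exact Real.one_le_rpow h hk
      have h2 := smoothTransition.nonneg (‖x‖ ^ 2 - 1)
      have h3 := mul_nonneg h2 (sub_nonneg.2 h1)
      linarith
  · intro x hx
    beta_reduce
    rw [smoothTransition.one_of_one_le (by nlinarith), hpow]
    ring

/-- If a negative power of a positive convex function is integrable, the function is coercive. -/
theorem ConvexOn.isBounded_sublevel {n : ℕ} {U : En n → ℝ} (hU : Continuous U)
    (hconv : ConvexOn ℝ univ U) (hpos : ∀ x, 0 < U x) {a : ℝ} (ha : 0 ≤ a)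
    (hint : Integrable (fun x => Real.exp (-(a * Real.log (U x))))) {M : ℝ} (hM : U 0 < M) :
    Bornology.IsBounded {x | U x < M} := by
  have hMpos : 0 < M := (hpos 0).trans hM
  have hopen : IsOpen {x | U x < M} := isOpen_lt hU continuous_const
  obtain ⟨r, hr, hball⟩ := Metric.isOpen_iff.1 hopen 0 hM
  have hcvx : Convex ℝ {x | U x < M} := by simpa using hconv.convex_lt M
  refine hcvx.isBounded_of_measure_ne_top volume ?_ hr hball
  refine ne_top_of_le_ne_top
    (hint.measure_norm_ge_lt_top (Real.exp_pos (-(a * Real.log M)))).ne (measure_mono ?_)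
  intro x hx
  rw [mem_ofPred_eq, Real.norm_of_nonneg (Real.exp_pos _).le, Real.exp_le_exp, neg_le_neg_iff]
  exact mul_le_mul_of_nonneg_left (Real.log_le_log (hpos x) (le_of_lt hx)) ha

/-- Cauchy-type measures `dμ ∝ U^{-(n+β)}` (`U` convex, `U ≥ c₀ > 0`, `β > 0`)
satisfy a `φ`-Lyapunov condition with `φ(u) = c u^{(k-2)/k}`, with `W(x) = |x|^k` for large
`|x|`, whenever `k > 2` admits `ε > 0` with `k + nε - 2 - β(1-ε) < 0`. -/
theorem stmt15 {n : ℕ} (hn : 0 < n) (U : En n → ℝ) (hU : ContDiff ℝ 2 U)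
    (hUconv : ConvexOn ℝ Set.univ U)
    (c₀ : ℝ) (hc₀ : 0 < c₀) (hUpos : ∀ x, c₀ ≤ U x)
    (β : ℝ) (hβ : 0 < β)
    (hVint : Integrable (fun x => Real.exp (-(((n : ℝ) + β) * Real.log (U x)))))
    (k : ℝ) (hk : 2 < k)
    (hkε : ∃ ε : ℝ, 0 < ε ∧ k + n * ε - 2 - β * (1 - ε) < 0) :
    ∃ c b R : ℝ, 0 < c ∧ 0 < b ∧ 0 < R ∧
      ∃ W : En n → ℝ, ContDiff ℝ 2 W ∧ (∀ x, 1 ≤ W x) ∧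
        (∀ x, Lop (fun y => ((n : ℝ) + β) * Real.log (U y)) W x
            ≤ -c * W x ^ ((k - 2) / k) + (if ‖x‖ ≤ R then b else 0)) ∧
        ∃ R' : ℝ, ∀ x, R' ≤ ‖x‖ → W x = ‖x‖ ^ k := by
  obtain ⟨ε, hε, hkε⟩ := hkε
  have hpos : ∀ x, 0 < U x := fun x => hc₀.trans_le (hUpos x)
  have hnβ : 0 < (n : ℝ) + β := by positivity
  have hε1 : ε < 1 := by
    by_contra! h
    have h1 : 0 ≤ (n : ℝ) * ε := by positivity
    nlinarith
  have hM : U 0 < U 0 / ε := by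
    rw [lt_div_iff₀ hε]
    nlinarith [hpos 0]
  obtain ⟨R₀, hR₀⟩ := isBounded_iff_forall_norm_le.1
    (hUconv.isBounded_sublevel hU.continuous hpos hnβ.le hVint hM)
  obtain ⟨W, hW, hW1, hWeq⟩ := exists_contDiff_eq_norm_rpow n (k := k) (by linarith)
  set V : En n → ℝ := fun y => ((n : ℝ) + β) * Real.log (U y) with hVdef
  have hV : ContDiff ℝ 2 V := contDiff_const.mul (hU.log fun x => (hpos x).ne')
  set δ := -(k + n * ε - 2 - β * (1 - ε)) with hδdef
  have hδ : 0 < δ := by linarith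
  have hcont : Continuous fun x => Lop V W x + k * δ * W x ^ ((k - 2) / k) :=
    (continuous_Lop (hV.of_le one_le_two) hW).add (continuous_const.mul
      (hW.continuous.rpow_const fun x => Or.inl (by linarith [hW1 x])))
  set R := max R₀ 2
  obtain ⟨B, hB⟩ := ((isCompact_closedBall (0 : En n) R).bddAbove_image hcont.continuousOn)
  refine ⟨k * δ, max B 1, R, by positivity, by positivity, by positivity, W, hW, hW1,
    fun x => ?_, 2, hWeq⟩
  split_ifs with hx
  · have h := hB (mem_image_of_mem _ (mem_closedBall_zero_iff.2 hx))
    have h' := h.trans (le_max_left B 1)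
    linarith
  · push Not at hx
    have hx2 : 2 < ‖x‖ := (le_max_right _ _).trans_lt hx
    have hx0 : x ≠ 0 := norm_pos_iff.1 (by linarith)
    have hev : W =ᶠ[nhds x] fun y => ‖y‖ ^ k := by
      filter_upwards [continuous_norm.continuousAt.eventually_const_lt hx2] with y hy
      exact hWeq y hy.le
    have hUx : U 0 / ε ≤ U x := by
      by_contra! h
      exact absurd (hR₀ x h) (not_le.2 ((le_max_left _ _).trans_lt hx))
    have hUd : DifferentiableAt ℝ U x := hU.differentiable two_ne_zero x
    have hVx : fderiv ℝ V x x = (n + β) * (fderiv ℝ U x x / U x) := by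
      rw [((hUd.hasFDerivAt.log (hpos x).ne').const_mul ((n : ℝ) + β)).fderiv]
      simp only [smul_apply, smul_eq_mul]
      ring
    have hratio : 1 - ε ≤ fderiv ℝ U x x / U x := by
      rw [le_div_iff₀ (hpos x)]
      rw [div_le_iff₀ hε] at hUx
      linarith [hUconv.sub_le_fderiv_apply_self hUd]
    have hWpow : W x ^ ((k - 2) / k) = ‖x‖ ^ (k - 2) := by
      rw [hWeq x hx2.le, ← Real.rpow_mul (norm_nonneg x), mul_div_cancel₀ _ (by linarith)]
    rw [Lop_congr hev, Lop_norm_rpow V (by linarith) hx0, hWpow, hVx]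
    have hle : n + k - 2 - (n + β) * (fderiv ℝ U x x / U x) ≤ -δ := by
      have := mul_le_mul_of_nonneg_left hratio hnβ.le
      rw [hδdef]
      linarith
    have hkx : 0 ≤ k * ‖x‖ ^ (k - 2) := by positivity
    have := mul_le_mul_of_nonneg_left hle hkx
    linarith
end
end
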